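/- arXiv:math/0505546 — 2 statements merged into one kernel-verified Lean document; each statement's English description precedes it below -/
import Mathlib

section
/- Let R be a polynomial with real coefficients of degree N ≥ 2 such that R(0) = 0, c := R'(0) > 1, and there exists a > 0 with the property that every complex number z with R(z) ∈ [0,a] satisfies z ∈ [0,a]. Fix z₀ ∈ [0,a]. Then for every complex s with Re(s) > d_R := 2·log N / log c, the limit ζ_{z₀,R}(s) := lim_{n→∞} Σ_{z ∈ R^{-n}{z₀}, z ≠ 0} (cⁿ z)^{-s/2} exists, and the resulting function s ↦ ζ_{z₀,R}(s) is holomorphic on the half-plane {s : Re(s) > d_R}. -/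
open Polynomial Filter

/-- The `n`-fold composition `R^{∘n}` of a polynomial, with `R^{∘0} = X`. -/
noncomputable def polyIter (R : Polynomial ℝ) : ℕ → Polynomial ℝ
  | 0 => Polynomial.X
  | n + 1 => R.comp (polyIter R n)

/-- The multiset `R^{-n}{z₀}` of complex roots (with multiplicity) of `R^{∘n}(z) - z₀`. -/
noncomputable def preimageRoots (R : Polynomial ℝ) (z₀ : ℝ) (n : ℕ) : Multiset ℂ :=
  ((polyIter R n - Polynomial.C z₀).map (algebraMap ℝ ℂ)).roots

/-- The partial sum `Σ_{z ∈ R^{-n}{z₀}, z ≠ 0} (cⁿ z)^{-s/2}`. -/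
noncomputable def zetaPartial (R : Polynomial ℝ) (c z₀ : ℝ) (n : ℕ) (s : ℂ) : ℂ :=
  ((preimageRoots R z₀ n).map
    (fun z => if z = 0 then 0 else ((c : ℂ) ^ n * z) ^ (-s / 2))).sum

/-- Membership of a complex number in the real interval `[0, a]`. -/
def memIcc (a : ℝ) (z : ℂ) : Prop := z.im = 0 ∧ z.re ∈ Set.Icc 0 a

/-- Value and derivative at `0` of a monic polynomial whose roots lie in `[0, a]`. -/
theorem abs_eval_zero_prod_X_sub_C_le {a : ℝ} (M : Multiset ℝ) (hM : ∀ z ∈ M, z ∈ Set.Icc 0 a) :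
    |(M.map fun z => X - C z).prod.eval 0| ≤ (1 + a) ^ M.card ∧
      |(M.map fun z => X - C z).prod.derivative.eval 0| ≤ (1 + a) ^ M.card := by
  induction M using Multiset.induction_on with
  | empty => simp
  | cons x M ih =>
    obtain ⟨h0, h1⟩ := ih fun z hz => hM z (Multiset.mem_cons_of_mem hz)
    obtain ⟨hx0, hxa⟩ := hM x (Multiset.mem_cons_self x M)
    simp only [Multiset.map_cons, Multiset.prod_cons, Multiset.card_cons, derivative_mul,
      derivative_sub, derivative_X, derivative_C, eval_add, eval_mul, eval_sub, eval_X, eval_C,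
      pow_succ, sub_zero, one_mul, zero_sub]
    set u := (M.map fun z => X - C z).prod.eval 0
    set v := (M.map fun z => X - C z).prod.derivative.eval 0
    have hv : |-x * v| ≤ a * (1 + a) ^ M.card := by
      rw [abs_mul, abs_neg, abs_of_nonneg hx0]
      gcongr
      exact hx0.trans hxa
    have hu : |-x * u| ≤ a * (1 + a) ^ M.card := by
      rw [abs_mul, abs_neg, abs_of_nonneg hx0]
      gcongr
      exact hx0.trans hxa
    have := abs_add_le u (-x * v)
    have := abs_nonneg u
    constructor <;> nlinarith

/-- If a polynomial has all its roots in `[0, a]`, then its second smallest root is bounded below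
in terms of its derivative at `0`. -/
theorem derivative_eval_zero_le_mul_root {a : ℝ} {p : ℝ[X]} {b z : ℝ} {M : Multiset ℝ}
    (hp : p.Splits) (hroots : p.roots = b ::ₘ z ::ₘ M) (hbz : b ≤ z)
    (hM : ∀ x ∈ p.roots, x ∈ Set.Icc 0 a) :
    p.derivative.eval 0 ≤ |p.leadingCoeff| * ((2 + a) * (1 + a) ^ M.card) * z := by
  have hb : b ∈ Set.Icc 0 a := hM b (by simp [hroots])
  have hz : z ∈ Set.Icc 0 a := hM z (by simp [hroots])
  obtain ⟨h0, h1⟩ := abs_eval_zero_prod_X_sub_C_le M fun x hx => hM x (by simp [hroots, hx])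
  have h := hp.eq_prod_roots
  rw [hroots] at h
  simp only [Multiset.map_cons, Multiset.prod_cons] at h
  set Q := (M.map fun z => X - C z).prod
  have hder : p.derivative.eval 0 =
      p.leadingCoeff * (b * z * Q.derivative.eval 0 - (b + z) * Q.eval 0) := by
    conv_lhs => rw [h]
    simp only [derivative_mul, derivative_sub, derivative_X, derivative_C, eval_add, eval_mul,
      eval_sub, eval_X, eval_C, eval_one, eval_zero]
    ring
  rw [hder, mul_assoc |p.leadingCoeff|]
  refine (le_abs_self _).trans ?_
  rw [abs_mul p.leadingCoeff]
  refine mul_le_mul_of_nonneg_left ?_ (abs_nonneg _)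
  refine (norm_sub_le (b * z * Q.derivative.eval 0) ((b + z) * Q.eval 0)).trans ?_
  simp only [Real.norm_eq_abs]
  rw [abs_mul (b * z), abs_mul (b + z), abs_of_nonneg (mul_nonneg hb.1 hz.1 : 0 ≤ b * z),
    abs_of_nonneg (add_nonneg hb.1 hz.1 : 0 ≤ b + z)]
  calc b * z * |Q.derivative.eval 0| + (b + z) * |Q.eval 0|
      ≤ a * z * (1 + a) ^ M.card + (z + z) * (1 + a) ^ M.card := by
        have := hz.1
        have := hb.2
        have ha : 0 ≤ a := hz.1.trans hz.2
        gcongr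
    _ = _ := by ring

/-- The inverses of the roots of a split polynomial sum to `-p'(0) / p(0)`. -/
theorem sum_inv_roots {p : ℝ[X]} (hp : p.Splits) (h0 : p.eval 0 ≠ 0) :
    (p.roots.map fun z => z⁻¹).sum = -(p.derivative.eval 0 / p.eval 0) := by
  rw [hp.eval_derivative_div_eval_of_ne_zero h0, ← Multiset.sum_map_neg', Multiset.map_map]
  simp

/-- Every root of a polynomial with nonnegative roots is at least `-p(0) / p'(0)`. -/
theorem le_derivative_mul_root {p : ℝ[X]} (hp : p.Splits) {c w : ℝ} (hc : 0 < c) (hw : 0 ≤ w)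
    (hder : p.derivative.eval 0 = c) (hval : p.eval 0 = -w) (hM : ∀ x ∈ p.roots, 0 ≤ x)
    {z : ℝ} (hz : z ∈ p.roots) : w ≤ c * z := by
  rcases hw.eq_or_lt with rfl | hw
  · exact mul_nonneg hc.le (hM z hz)
  have h0 : p.eval 0 ≠ 0 := by rw [hval]; linarith
  have hz0 : 0 < z := (hM z hz).lt_of_ne' fun h => h0 (by
    simpa [h] using (mem_roots'.1 hz).2)
  have hs := sum_inv_roots hp h0
  rw [hder, hval, div_neg, neg_neg] at hs
  have : z⁻¹ ≤ c / w := by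
    rw [← hs]
    refine Multiset.single_le_sum ?_ _ (Multiset.mem_map_of_mem _ hz)
    intro x hx
    obtain ⟨y, hy, rfl⟩ := Multiset.mem_map.1 hx
    exact inv_nonneg.2 (hM y hy)
  rw [inv_eq_one_div, div_le_div_iff₀ hz0 hw] at this
  linarith

/-- Upper bound for the smallest root of a polynomial all of whose other roots are at least
`δ`. -/
theorem derivative_mul_min_root_le {p : ℝ[X]} (hp : p.Splits) {c w δ b : ℝ} {M : Multiset ℝ}
    (hc : 0 < c) (hw : 0 ≤ w) (hδ : 0 < δ)
    (hder : p.derivative.eval 0 = c) (hval : p.eval 0 = -w) (hroots : p.roots = b ::ₘ M)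
    (hb : 0 ≤ b) (hmin : ∀ x ∈ M, b ≤ x) (hM : ∀ x ∈ M, δ ≤ x) :
    c * b ≤ w * (1 + M.card * (M.card + 1) / (c * δ) * w) := by
  rcases hw.eq_or_lt with rfl | hw
  · have h0 : (0 : ℝ) ∈ p.roots := by
      refine mem_roots'.2 ⟨?_, by simpa using hval⟩
      rintro rfl
      simp at hroots
    rw [hroots, Multiset.mem_cons] at h0
    have : b ≤ 0 := by
      rcases h0 with h0 | h0
      · exact h0.ge
      · exact hmin 0 h0
    have : b = 0 := le_antisymm this hb
    simp [this]
  have h0 : p.eval 0 ≠ 0 := by rw [hval]; linarith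
  have hb0 : 0 < b := hb.lt_of_ne' fun h => h0 (by
    have : b ∈ p.roots := by simp [hroots]
    simpa [h] using (mem_roots'.1 this).2)
  have hs := sum_inv_roots hp h0
  rw [hder, hval, div_neg, neg_neg, hroots, Multiset.map_cons, Multiset.sum_cons] at hs
  have key : ∀ t : ℝ, 0 < t → (∀ x ∈ M, t ≤ x) → c / w ≤ b⁻¹ + M.card * t⁻¹ := by
    intro t ht h
    rw [← hs, ← nsmul_eq_mul]
    gcongr
    have := Multiset.sum_le_card_nsmul (M.map fun z => z⁻¹) t⁻¹ (by
      intro x hx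
      obtain ⟨y, hy, rfl⟩ := Multiset.mem_map.1 hx
      exact inv_anti₀ ht (h y hy))
    simpa using this
  have h1 := key b hb0 hmin
  have h2 := key δ hδ hM
  have h1' : c * b ≤ w * (M.card + 1) := by
    rw [div_le_iff₀ hw] at h1
    have := mul_le_mul_of_nonneg_right h1 hb0.le
    field_simp at this
    linarith
  have h2' : c * b ≤ w * (1 + M.card * b / δ) := by
    rw [div_le_iff₀ hw] at h2
    have := mul_le_mul_of_nonneg_right h2 hb0.le
    field_simp at this
    field_simp
    linarith
  refine h2'.trans ?_
  gcongr
  have h3 : b ≤ w * (M.card + 1) / c := by rw [le_div_iff₀ hc]; linarith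
  calc M.card * b / δ ≤ M.card * (w * (M.card + 1) / c) / δ := by gcongr
    _ = _ := by field_simp

/-- The roots of `p ∘ q` are the `q`-preimages of the roots of `p`. -/
theorem splits_comp_and_roots {p q : ℝ[X]} (hp : p.Splits) (hp0 : p ≠ 0)
    (hq : ∀ w ∈ p.roots, (q - C w).Splits ∧ q - C w ≠ 0) :
    (p.comp q).Splits ∧ (p.comp q).roots = p.roots.bind fun w => (q - C w).roots := by
  have h : p.comp q = C p.leadingCoeff * (p.roots.map fun w => q - C w).prod := by
    conv_lhs => rw [hp.eq_prod_roots]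
    simp [multiset_prod_comp, Multiset.map_map]
  rw [h]
  refine ⟨(Splits.C _).mul (Splits.multisetProd ?_), ?_⟩
  · intro f hf
    obtain ⟨w, hw, rfl⟩ := Multiset.mem_map.1 hf
    exact (hq w hw).1
  · rw [roots_C_mul _ (leadingCoeff_ne_zero.2 hp0), roots_multiset_prod, Multiset.bind_map]
    intro hf
    obtain ⟨w, hw, h⟩ := Multiset.mem_map.1 hf
    exact (hq w hw).2 h

theorem polyIter_succ' (R : ℝ[X]) (n : ℕ) : polyIter R (n + 1) = (polyIter R n).comp R := by
  induction n with
  | zero => simp [polyIter]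
  | succ n ih =>
    calc polyIter R (n + 1 + 1) = R.comp (polyIter R (n + 1)) := rfl
      _ = (R.comp (polyIter R n)).comp R := by rw [ih, comp_assoc]

/-- The hypothesis on complex preimages forces `R - w` to split over the reals. -/
theorem splits_sub_C_of_preimage {R : ℝ[X]} {a w : ℝ}
    (hinv : ∀ z : ℂ, memIcc a (aeval z R) → memIcc a z) (hw : w ∈ Set.Icc 0 a) :
    (R - C w).Splits ∧ ∀ z ∈ (R - C w).roots, z ∈ Set.Icc 0 a := by
  constructor
  · refine Splits.of_splits_map_of_injective (i := algebraMap ℝ ℂ)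
      (algebraMap ℝ ℂ).injective (IsAlgClosed.splits _) ?_
    intro z hz
    have hz' : aeval z R = (w : ℂ) := by
      have := (mem_roots'.1 hz).2
      rw [IsRoot, eval_map_algebraMap] at this
      simpa [sub_eq_zero] using this
    have him : z.im = 0 := (hinv z (by simpa [hz', memIcc] using hw)).1
    exact ⟨z.re, Complex.ext (by simp) (by simp [him])⟩
  · intro z hz
    have hz' : R.eval z = w := by
      simpa [sub_eq_zero] using (mem_roots'.1 hz).2
    have h : aeval (z : ℂ) R = ((R.eval z : ℝ) : ℂ) := by
      simpa using aeval_algebraMap_apply ℂ z R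
    have := hinv z (by simpa [h, hz', memIcc] using hw)
    simpa [memIcc] using this

theorem natDegree_polyIter (R : ℝ[X]) (n : ℕ) : (polyIter R n).natDegree = R.natDegree ^ n := by
  induction n with
  | zero => simp [polyIter]
  | succ n ih => rw [polyIter, natDegree_comp, ih, pow_succ']

/-- The iterated preimages of `z₀` are real, lie in `[0, a]`, and form a tree. -/
theorem splits_polyIter_sub_C {R : ℝ[X]} {a z₀ : ℝ} (hR : 0 < R.natDegree)
    (hinv : ∀ z : ℂ, memIcc a (aeval z R) → memIcc a z) (hz₀ : z₀ ∈ Set.Icc 0 a) (n : ℕ) :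
    (polyIter R n - C z₀).Splits ∧ (∀ w ∈ (polyIter R n - C z₀).roots, w ∈ Set.Icc 0 a) ∧
      (polyIter R (n + 1) - C z₀).roots =
        (polyIter R n - C z₀).roots.bind fun w => (R - C w).roots := by
  have hne : ∀ (p : ℝ[X]) (w : ℝ), 0 < p.natDegree → p - C w ≠ 0 := fun p w hp h => by
    have := natDegree_sub_C (p := p) (a := w)
    rw [h, natDegree_zero] at this
    omega
  have hdeg : ∀ n, 0 < (polyIter R n).natDegree := fun n => by
    rw [natDegree_polyIter]
    positivity
  have hstep : ∀ n, (polyIter R n - C z₀).Splits →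
      (∀ w ∈ (polyIter R n - C z₀).roots, w ∈ Set.Icc 0 a) →
      (polyIter R (n + 1) - C z₀).Splits ∧ (polyIter R (n + 1) - C z₀).roots =
        (polyIter R n - C z₀).roots.bind fun w => (R - C w).roots := by
    intro n hs hI
    have hcomp : polyIter R (n + 1) - C z₀ = (polyIter R n - C z₀).comp R := by
      rw [polyIter_succ', sub_comp, C_comp]
    rw [hcomp]
    exact splits_comp_and_roots hs (hne _ _ (hdeg n)) fun w hw =>
      ⟨(splits_sub_C_of_preimage hinv (hI w hw)).1, hne _ _ hR⟩
  have hall : ∀ n, (polyIter R n - C z₀).Splits ∧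
      ∀ w ∈ (polyIter R n - C z₀).roots, w ∈ Set.Icc 0 a := by
    intro n
    induction n with
    | zero =>
      refine ⟨Splits.X_sub_C z₀, fun w hw => ?_⟩
      rw [polyIter, roots_X_sub_C, Multiset.mem_singleton] at hw
      exact hw ▸ hz₀
    | succ n ih =>
      obtain ⟨hs, hr⟩ := hstep n ih.1 ih.2
      refine ⟨hs, fun z hz => ?_⟩
      rw [hr, Multiset.mem_bind] at hz
      obtain ⟨w, hw, hz⟩ := hz
      exact (splits_sub_C_of_preimage hinv (ih.2 w hw)).2 z hz
  exact ⟨(hall n).1, (hall n).2, (hstep n (hall n).1 (hall n).2).2⟩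

/-- The roots of `R - w`, for `w ∈ [0, a]`, consist of one branch asymptotic to `w / c` and of
branches bounded away from `0`. -/
theorem exists_root_branches {R : ℝ[X]} {N : ℕ} {a c : ℝ} (hN : R.natDegree = N) (hN2 : 2 ≤ N)
    (hR0 : R.eval 0 = 0) (hc : R.derivative.eval 0 = c) (hc0 : 0 < c) (ha : 0 ≤ a)
    (hinv : ∀ z : ℂ, memIcc a (aeval z R) → memIcc a z) :
    ∃ (b : ℝ → ℝ) (B : ℝ → Multiset ℝ) (δ K : ℝ), 0 < δ ∧ δ ≤ 1 ∧ 0 ≤ K ∧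
      (∀ w ∈ Set.Icc 0 a, (R - C w).roots = b w ::ₘ B w) ∧
      (∀ w ∈ Set.Icc 0 a, w ≤ c * b w) ∧
      (∀ w ∈ Set.Icc 0 a, c * b w ≤ w * (1 + K * w)) ∧
      ∀ w ∈ Set.Icc 0 a, ∀ z ∈ B w, δ ≤ z := by
  have hsplit : ∀ w ∈ Set.Icc 0 a, (R - C w).Splits := fun w hw =>
    (splits_sub_C_of_preimage hinv hw).1
  have hmem : ∀ w ∈ Set.Icc 0 a, ∀ z ∈ (R - C w).roots, z ∈ Set.Icc 0 a := fun w hw =>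
    (splits_sub_C_of_preimage hinv hw).2
  have hcard : ∀ w ∈ Set.Icc 0 a, (R - C w).roots.card = N := fun w hw => by
    rw [← (hsplit w hw).natDegree_eq_card_roots, natDegree_sub_C, hN]
  have hder : ∀ w, (R - C w).derivative.eval 0 = c := fun w => by simp [hc]
  have hval : ∀ w, (R - C w).eval 0 = -w := fun w => by simp [hR0]
  have hlead : ∀ w, (R - C w).leadingCoeff = R.leadingCoeff := fun w =>
    leadingCoeff_sub_of_degree_lt <| degree_C_le.trans_lt <|
      natDegree_pos_iff_degree_pos.1 (by omega)
  have hl : 0 < |R.leadingCoeff| := abs_pos.2 <| leadingCoeff_ne_zero.2 fun h => by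
    simp [h] at hN
    omega
  have hbranch : ∀ w, ∃ (b : ℝ) (B : Multiset ℝ), w ∈ Set.Icc 0 a →
      (R - C w).roots = b ::ₘ B ∧ ∀ x ∈ B, b ≤ x := by
    intro w
    by_cases hw : w ∈ Set.Icc 0 a
    · obtain ⟨b, hb, hmin⟩ := Multiset.exists_min_image id (s := (R - C w).roots) (by
        rw [← Multiset.card_pos, hcard w hw]
        omega)
      obtain ⟨B, hB⟩ := Multiset.exists_cons_of_mem hb
      exact ⟨b, B, fun _ => ⟨hB, fun x hx => hmin x (by simp [hB, hx])⟩⟩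
    · exact ⟨0, 0, fun h => absurd h hw⟩
  choose b B hbB using hbranch
  set L := |R.leadingCoeff| * ((2 + a) * (1 + a) ^ (N - 2))
  have hL : 0 < L := by positivity
  set δ := min 1 (c / L)
  have hδ : 0 < δ := by positivity
  have hBcard : ∀ w ∈ Set.Icc 0 a, (B w).card = N - 1 := fun w hw => by
    have := hcard w hw
    rw [(hbB w hw).1, Multiset.card_cons] at this
    omega
  have hBδ : ∀ w ∈ Set.Icc 0 a, ∀ z ∈ B w, δ ≤ z := by
    intro w hw z hz
    obtain ⟨M, hM⟩ := Multiset.exists_cons_of_mem hz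
    have hMc : M.card = N - 2 := by
      have := hBcard w hw
      rw [hM, Multiset.card_cons] at this
      omega
    have := derivative_eval_zero_le_mul_root (hsplit w hw) (hM ▸ (hbB w hw).1)
      ((hbB w hw).2 z hz) (hmem w hw)
    rw [hder, hlead, hMc] at this
    exact (min_le_right _ _).trans ((div_le_iff₀' hL).2 this)
  refine ⟨b, B, δ, (N - 1 : ℕ) * ((N - 1 : ℕ) + 1) / (c * δ), hδ, min_le_left _ _, by positivity,
    fun w hw => (hbB w hw).1, fun w hw => ?_, fun w hw => ?_, hBδ⟩
  · exact le_derivative_mul_root (hsplit w hw) hc0 hw.1 (hder w) (hval w)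
      (fun x hx => (hmem w hw x hx).1) (by simp [(hbB w hw).1])
  · have := derivative_mul_min_root_le (hsplit w hw) hc0 hw.1 hδ (hder w) (hval w) (hbB w hw).1
      (hmem w hw _ (by simp [(hbB w hw).1])).1 (hbB w hw).2 (hBδ w hw)
    rwa [hBcard w hw] at this

/-- The term `x^{-s/2}`, with the convention that it vanishes at `x = 0`. -/
noncomputable def zetaTerm (s : ℂ) (x : ℝ) : ℂ := if x = 0 then 0 else (x : ℂ) ^ (-s / 2)

/-- The modulus of `zetaTerm` on an exponent of real part `σ`. -/
noncomputable def zetaTermNorm (σ x : ℝ) : ℝ := if x = 0 then 0 else x ^ (-σ / 2)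

theorem norm_zetaTerm {s : ℂ} {x : ℝ} (hx : 0 ≤ x) : ‖zetaTerm s x‖ = zetaTermNorm s.re x := by
  unfold zetaTerm zetaTermNorm
  split_ifs with h
  · simp
  · rw [Complex.norm_cpow_eq_rpow_re_of_pos (hx.lt_of_ne' h)]
    simp

theorem zetaTermNorm_nonneg {σ x : ℝ} (hx : 0 ≤ x) : 0 ≤ zetaTermNorm σ x := by
  unfold zetaTermNorm
  split_ifs
  · exact le_rfl
  · positivity

theorem zetaTermNorm_anti {σ x y : ℝ} (hσ : 0 ≤ σ) (hx : 0 < x) (hxy : x ≤ y) :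
    zetaTermNorm σ y ≤ zetaTermNorm σ x := by
  rw [zetaTermNorm, zetaTermNorm, if_neg (hx.trans_le hxy).ne', if_neg hx.ne']
  exact Real.rpow_le_rpow_of_nonpos hx hxy (by linarith)

theorem differentiable_zetaTerm (x : ℝ) : Differentiable ℂ fun s => zetaTerm s x := by
  unfold zetaTerm
  split_ifs with h
  · exact differentiable_const _
  · have hx : (x : ℂ) ≠ 0 := by exact_mod_cast h
    exact (differentiable_id.neg.div_const 2).const_cpow (Or.inl hx)

theorem norm_zetaTerm_sub_le {s : ℂ} {x y t T r : ℝ} (hs : ‖s‖ ≤ r) (hx : 0 ≤ x) (hxy : x ≤ y)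
    (hyt : y ≤ x * (1 + t)) (ht : 0 ≤ t) (htT : t ≤ T) :
    ‖zetaTerm s y - zetaTerm s x‖ ≤ zetaTermNorm s.re x * (r * Real.exp (r * T) * t) := by
  rcases hx.eq_or_lt with rfl | hx0
  · have : y = 0 := le_antisymm (by simpa using hyt) hxy
    simp [this, zetaTermNorm]
  have hr : 0 ≤ r := (norm_nonneg s).trans hs
  have hy0 : 0 < y := hx0.trans_le hxy
  set ρ := y / x with hρ
  have hρ0 : 0 < ρ := div_pos hy0 hx0
  have hyρ : y = x * ρ := by rw [hρ]; field_simp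
  have h1ρ : 1 ≤ ρ := by rwa [hρ, one_le_div hx0]
  have hρt : ρ ≤ 1 + t := by rwa [hρ, div_le_iff₀' hx0]
  have hfac : zetaTerm s y = zetaTerm s x * (ρ : ℂ) ^ (-s / 2) := by
    rw [zetaTerm, zetaTerm, if_neg hy0.ne', if_neg hx0.ne', hyρ, Complex.ofReal_mul,
      Complex.mul_cpow_ofReal_nonneg hx hρ0.le]
  have hlog : Real.log ρ ≤ t := (Real.log_le_sub_one_of_pos hρ0).trans (by linarith)
  have hlog0 : 0 ≤ Real.log ρ := Real.log_nonneg h1ρ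
  have hexp : (ρ : ℂ) ^ (-s / 2) = Complex.exp (Real.log ρ * (-s / 2)) := by
    rw [Complex.cpow_def_of_ne_zero (by exact_mod_cast hρ0.ne'), Complex.ofReal_log hρ0.le]
  set u : ℂ := Real.log ρ * (-s / 2) with hu
  have hun : ‖u‖ ≤ r * t := by
    rw [hu, norm_mul, norm_div, norm_neg, Complex.norm_real, Real.norm_of_nonneg hlog0,
      mul_comm r t, RCLike.norm_ofNat]
    refine mul_le_mul hlog ?_ (by positivity) ht
    linarith [norm_nonneg s]
  have hu1 : ‖Complex.exp u - 1‖ ≤ ‖u‖ * Real.exp ‖u‖ := by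
    simpa using Complex.norm_exp_sub_sum_le_norm_mul_exp u 1
  rw [hfac, ← mul_sub_one, norm_mul, norm_zetaTerm hx, hexp]
  refine mul_le_mul_of_nonneg_left (hu1.trans ?_) (zetaTermNorm_nonneg hx)
  calc ‖u‖ * Real.exp ‖u‖ ≤ (r * t) * Real.exp (r * T) := by
        gcongr
        exact hun.trans (by gcongr)
    _ = _ := by ring

/-- A tree of multisets of reals in `[0, a]` in which every `w` has one child `b w` close to
`w / c` and all its other children bounded below by `δ`. -/
structure IsContractingTree (c a δ K : ℝ) (N : ℕ) (b : ℝ → ℝ) (B : ℝ → Multiset ℝ)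
    (P : ℕ → Multiset ℝ) : Prop where
  succ_eq : ∀ n, P (n + 1) = (P n).bind fun w => b w ::ₘ B w
  mem_Icc : ∀ n, ∀ w ∈ P n, w ∈ Set.Icc 0 a
  card_eq : ∀ n, (P n).card = N ^ n
  le_mul : ∀ w ∈ Set.Icc 0 a, w ≤ c * b w
  mul_le : ∀ w ∈ Set.Icc 0 a, c * b w ≤ w * (1 + K * w)
  le_of_mem : ∀ w ∈ Set.Icc 0 a, ∀ z ∈ B w, δ ≤ z
  card_le : ∀ w ∈ Set.Icc 0 a, (B w).card ≤ N

namespace IsContractingTree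

variable {c a δ K : ℝ} {N : ℕ} {b : ℝ → ℝ} {B : ℝ → Multiset ℝ} {P : ℕ → Multiset ℝ}

theorem sum_succ (h : IsContractingTree c a δ K N b B P) {E : Type*} [AddCommMonoid E] (f : ℝ → E)
    (n : ℕ) : ((P (n + 1)).map f).sum =
      ((P n).map fun w => f (b w) + ((B w).map f).sum).sum := by
  rw [h.succ_eq, Multiset.map_bind, Multiset.sum_bind]
  simp

theorem sum_zetaTermNorm_tail_le (h : IsContractingTree c a δ K N b B P) (hc : 0 < c) (hδ : 0 < δ)
    {σ w : ℝ} (hσ : 0 ≤ σ) (hw : w ∈ Set.Icc 0 a) (n : ℕ) :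
    ((B w).map fun z => zetaTermNorm σ (c ^ n * z)).sum ≤
      N * ((c ^ (-σ / 2)) ^ n * δ ^ (-σ / 2)) := by
  have hterm : zetaTermNorm σ (c ^ n * δ) = (c ^ (-σ / 2)) ^ n * δ ^ (-σ / 2) := by
    rw [zetaTermNorm, if_neg (by positivity), Real.mul_rpow (by positivity) hδ.le,
      ← Real.rpow_natCast, ← Real.rpow_natCast, ← Real.rpow_mul hc.le, ← Real.rpow_mul hc.le,
      mul_comm (n : ℝ)]
  have := Multiset.sum_le_card_nsmul ((B w).map fun z => zetaTermNorm σ (c ^ n * z))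
    ((c ^ (-σ / 2)) ^ n * δ ^ (-σ / 2)) (by
      intro x hx
      obtain ⟨z, hz, rfl⟩ := Multiset.mem_map.1 hx
      rw [← hterm]
      refine zetaTermNorm_anti hσ (by positivity) ?_
      have := h.le_of_mem w hw z hz
      gcongr)
  refine this.trans ?_
  rw [Multiset.card_map, nsmul_eq_mul]
  have : ((B w).card : ℝ) ≤ N := by exact_mod_cast h.card_le w hw
  gcongr

/-- The sums of absolute values are bounded to the right of the abscissa. -/
theorem exists_sum_zetaTermNorm_le (h : IsContractingTree c a δ K N b B P) (hc : 0 < c) (hδ : 0 < δ)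
    {σ : ℝ} (hσ : 0 ≤ σ) (hq : N * c ^ (-σ / 2) < 1) :
    ∃ A : ℝ, 0 ≤ A ∧ ∀ n, ((P n).map fun w => zetaTermNorm σ (c ^ n * w)).sum ≤ A := by
  set q := N * c ^ (-σ / 2) with hqdef
  have hq0 : 0 ≤ q := by positivity
  set D := δ ^ (-σ / 2)
  have hD : 0 ≤ D := by positivity
  set G : ℕ → ℝ := fun n => ((P n).map fun w => zetaTermNorm σ (c ^ n * w)).sum with hG
  have hstep : ∀ n, G (n + 1) ≤ G n + D * q ^ (n + 1) := by
    intro n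
    have hcst : D * q ^ (n + 1) =
        ((P n).map fun _ => N * ((c ^ (-σ / 2)) ^ (n + 1) * D)).sum := by
      rw [Multiset.map_const', Multiset.sum_replicate, h.card_eq, nsmul_eq_mul, hqdef]
      push_cast
      ring
    simp only [hG]
    rw [h.sum_succ, hcst, ← Multiset.sum_map_add]
    refine Multiset.sum_map_le_sum_map _ _ fun w hw => ?_
    have hwI := h.mem_Icc n w hw
    refine add_le_add ?_ (h.sum_zetaTermNorm_tail_le hc hδ hσ hwI _)
    rcases hwI.1.eq_or_lt with hw0 | hw0
    · have h1 := h.mul_le w hwI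
      have h2 := h.le_mul w hwI
      rw [← hw0] at h1 h2 ⊢
      have : b 0 = 0 := by
        have : c * b 0 = 0 := le_antisymm (by simpa using h1) h2
        simpa [hc.ne'] using this
      simp [this, zetaTermNorm]
    · refine zetaTermNorm_anti hσ (by positivity) ?_
      rw [pow_succ, mul_assoc]
      have := h.le_mul w hwI
      gcongr
  have hsum : Summable fun n => D * q ^ (n + 1) :=
    ((summable_nat_add_iff 1).2 (summable_geometric_of_lt_one hq0 hq)).mul_left D
  have hbound : ∀ n, G n ≤ G 0 + ∑ k ∈ Finset.range n, D * q ^ (k + 1) := by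
    intro n
    induction n with
    | zero => simp
    | succ n ih =>
      rw [Finset.sum_range_succ]
      linarith [hstep n]
  have hG0 : 0 ≤ G 0 := Multiset.sum_nonneg fun x hx => by
    obtain ⟨w, hw, rfl⟩ := Multiset.mem_map.1 hx
    exact zetaTermNorm_nonneg (mul_nonneg (by positivity) (h.mem_Icc 0 w hw).1)
  refine ⟨G 0 + ∑' k, D * q ^ (k + 1), ?_, fun n => (hbound n).trans ?_⟩
  · have : 0 ≤ ∑' k, D * q ^ (k + 1) := tsum_nonneg fun k => by positivity
    linarith
  · gcongr
    exact hsum.sum_le_tsum _ fun k _ => by positivity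

theorem zetaTermNorm_mul_le {σ τ ε w : ℝ} (hc : 1 < c) (hw : w ∈ Set.Icc 0 a)
    (hε0 : 0 ≤ ε) (hε : τ + 2 * ε ≤ σ) (hσ : σ ≤ τ + 2) (n : ℕ) :
    zetaTermNorm σ (c ^ n * w) * w ≤ zetaTermNorm τ (c ^ n * w) * ((c ^ (-ε)) ^ n * (1 + a)) := by
  have hc0 : 0 < c := by linarith
  rcases hw.1.eq_or_lt with rfl | hw0
  · simp [zetaTermNorm]
  have hx : 0 < c ^ n * w := by positivity
  have ha : 0 ≤ a := hw.1.trans hw.2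
  rw [zetaTermNorm, zetaTermNorm, if_neg hx.ne', if_neg hx.ne']
  have hsplit : -σ / 2 = -τ / 2 + -((σ - τ) / 2) := by ring
  rw [hsplit, Real.rpow_add hx, mul_assoc]
  refine mul_le_mul_of_nonneg_left ?_ (by positivity)
  rw [Real.mul_rpow (by positivity) hw0.le, mul_assoc]
  refine mul_le_mul ?_ ?_ (by positivity) (by positivity)
  · rw [← Real.rpow_natCast (c ^ (-ε)), ← Real.rpow_mul hc0.le, mul_comm (-ε),
      Real.rpow_mul hc0.le, Real.rpow_natCast]
    exact Real.rpow_le_rpow_of_exponent_le (one_le_pow₀ hc.le) (by linarith)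
  · calc w ^ (-((σ - τ) / 2)) * w = w ^ (1 - (σ - τ) / 2) := by
          rw [← Real.rpow_add_one hw0.ne']
          ring_nf
      _ ≤ (1 + a) ^ (1 - (σ - τ) / 2) :=
          Real.rpow_le_rpow hw0.le (by linarith [hw.2]) (by linarith)
      _ ≤ (1 + a) ^ (1 : ℝ) :=
          Real.rpow_le_rpow_of_exponent_le (by linarith) (by linarith)
      _ = 1 + a := Real.rpow_one _

/-- Consecutive partial sums differ by a summable amount, uniformly on small vertical strips
to the right of the abscissa. -/
theorem exists_summable_norm_sub_le (h : IsContractingTree c a δ K N b B P) (ha : 0 ≤ a)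
    (hc : 1 < c) (hδ : 0 < δ) (hδ1 : δ ≤ 1) (hK : 0 ≤ K) {τ ε : ℝ} (r : ℝ) (hτ : 0 ≤ τ) (hε : 0 < ε)
    (hq : N * c ^ (-τ / 2) < 1) :
    ∃ u : ℕ → ℝ, Summable u ∧ ∀ n, ∀ s : ℂ, ‖s‖ ≤ r → τ + 2 * ε ≤ s.re → s.re ≤ τ + 2 →
      ‖((P (n + 1)).map fun w => zetaTerm s (c ^ (n + 1) * w)).sum -
        ((P n).map fun w => zetaTerm s (c ^ n * w)).sum‖ ≤ u n := by
  have hc0 : 0 < c := by linarith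
  obtain ⟨A, hA0, hA⟩ := h.exists_sum_zetaTermNorm_le hc0 hδ hτ hq
  set q := N * c ^ (-τ / 2) with hqdef
  have hq0 : 0 ≤ q := by positivity
  set C := r * Real.exp (r * (K * a)) * K * (1 + a)
  set D := δ ^ (-(τ + 2) / 2)
  have hη : c ^ (-ε) < 1 := Real.rpow_lt_one_of_one_lt_of_neg hc (by linarith)
  refine ⟨fun n => C * A * (c ^ (-ε)) ^ n + D * q ^ (n + 1), ?_, ?_⟩
  · exact ((summable_geometric_of_lt_one (by positivity) hη).mul_left _).add
      (((summable_nat_add_iff 1).2 (summable_geometric_of_lt_one hq0 hq)).mul_left D)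
  intro n s hs hs1 hs2
  have hr : 0 ≤ r := (norm_nonneg s).trans hs
  have hσ : 0 ≤ s.re := by linarith
  have htail : ∀ w ∈ Set.Icc 0 a, ‖((B w).map fun z => zetaTerm s (c ^ (n + 1) * z)).sum‖ ≤
      N * ((c ^ (-τ / 2)) ^ (n + 1) * D) := by
    intro w hw
    calc ‖((B w).map fun z => zetaTerm s (c ^ (n + 1) * z)).sum‖
        ≤ ((B w).map fun z => zetaTermNorm s.re (c ^ (n + 1) * z)).sum := by
          refine (norm_multiset_sum_le _).trans_eq ?_
          rw [Multiset.map_map]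
          refine congrArg _ (Multiset.map_congr rfl fun z hz => ?_)
          have := h.le_of_mem w hw z hz
          exact norm_zetaTerm (mul_nonneg (by positivity) (hδ.le.trans this))
      _ ≤ N * ((c ^ (-s.re / 2)) ^ (n + 1) * δ ^ (-s.re / 2)) :=
          h.sum_zetaTermNorm_tail_le hc0 hδ hσ hw _
      _ ≤ _ := by
          have h1 : c ^ (-s.re / 2) ≤ c ^ (-τ / 2) :=
            Real.rpow_le_rpow_of_exponent_le hc.le (by linarith)
          have h2 : δ ^ (-s.re / 2) ≤ D :=
            Real.rpow_le_rpow_of_exponent_ge hδ hδ1 (by linarith)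
          gcongr
  have hmain : ∀ w ∈ Set.Icc 0 a, ‖zetaTerm s (c ^ (n + 1) * b w) - zetaTerm s (c ^ n * w)‖ ≤
      C * (c ^ (-ε)) ^ n * zetaTermNorm τ (c ^ n * w) := by
    intro w hw
    have hcn : 0 < c ^ n := by positivity
    have hpow : c ^ (n + 1) * b w = c ^ n * (c * b w) := by rw [pow_succ, mul_assoc]
    have h1 := norm_zetaTerm_sub_le (x := c ^ n * w) (y := c ^ (n + 1) * b w) (t := K * w)
      (T := K * a) hs (mul_nonneg hcn.le hw.1)
      (by rw [hpow]; exact mul_le_mul_of_nonneg_left (h.le_mul w hw) hcn.le)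
      (by rw [hpow, mul_assoc]; exact mul_le_mul_of_nonneg_left (h.mul_le w hw) hcn.le)
      (mul_nonneg hK hw.1) (mul_le_mul_of_nonneg_left hw.2 hK)
    have h2 := zetaTermNorm_mul_le hc hw hε.le hs1 hs2 n
    calc _ ≤ _ := h1
      _ = r * Real.exp (r * (K * a)) * K * (zetaTermNorm s.re (c ^ n * w) * w) := by ring
      _ ≤ r * Real.exp (r * (K * a)) * K *
          (zetaTermNorm τ (c ^ n * w) * ((c ^ (-ε)) ^ n * (1 + a))) := by gcongr
      _ = _ := by ring
  rw [h.sum_succ, ← Multiset.sum_map_sub]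
  refine (norm_multiset_sum_le _).trans ?_
  rw [Multiset.map_map]
  have hbound : ((P n).map fun w => C * (c ^ (-ε)) ^ n * zetaTermNorm τ (c ^ n * w) +
      N * ((c ^ (-τ / 2)) ^ (n + 1) * D)).sum ≤ C * A * (c ^ (-ε)) ^ n + D * q ^ (n + 1) := by
    rw [Multiset.sum_map_add, Multiset.sum_map_mul_left, Multiset.map_const',
      Multiset.sum_replicate, h.card_eq, nsmul_eq_mul]
    refine add_le_add ?_ (le_of_eq ?_)
    · rw [mul_right_comm C A]
      exact mul_le_mul_of_nonneg_left (hA n) (by positivity)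
    · rw [hqdef]
      push_cast
      ring
  refine le_trans (Multiset.sum_map_le_sum_map _ _ fun w hw => ?_) hbound
  have hwI := h.mem_Icc n w hw
  simp only [Function.comp_apply]
  rw [add_sub_right_comm]
  exact (norm_add_le _ _).trans (add_le_add (hmain w hwI) (htail w hwI))

/-- The partial sums over the levels of the tree converge to a holomorphic function. -/
theorem exists_limit (h : IsContractingTree c a δ K N b B P) (ha : 0 ≤ a) (hc : 1 < c)
    (hN : 1 ≤ N) (hδ : 0 < δ) (hδ1 : δ ≤ 1) (hK : 0 ≤ K) :
    ∃ ζ : ℂ → ℂ,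
      (∀ s : ℂ, 2 * Real.log N / Real.log c < s.re →
        Tendsto (fun n => ((P n).map fun w => zetaTerm s (c ^ n * w)).sum) atTop (nhds (ζ s))) ∧
      DifferentiableOn ℂ ζ {s : ℂ | 2 * Real.log N / Real.log c < s.re} := by
  set d := 2 * Real.log N / Real.log c with hd
  have hc0 : 0 < c := by linarith
  have hlogc : 0 < Real.log c := Real.log_pos hc
  have hN0 : (0 : ℝ) < N := by exact_mod_cast hN
  have hd0 : 0 ≤ d := by
    have : 0 ≤ Real.log N := Real.log_natCast_nonneg N
    positivity
  set S : ℕ → ℂ → ℂ := fun n s => ((P n).map fun w => zetaTerm s (c ^ n * w)).sum with hS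
  have hSdiff : ∀ n, Differentiable ℂ (S n) := by
    intro n
    have : ∀ M : Multiset ℝ, Differentiable ℂ fun s =>
        (M.map fun w => zetaTerm s (c ^ n * w)).sum := by
      intro M
      induction M using Multiset.induction_on with
      | empty => simp
      | cons x M ih =>
        simp only [Multiset.map_cons, Multiset.sum_cons]
        exact (differentiable_zetaTerm _).add ih
    exact this _
  have hlocal : ∀ s₀ : ℂ, d < s₀.re → ∃ ρ > 0, ∃ u : ℕ → ℝ, Summable u ∧
      ∀ n, ∀ s ∈ Metric.ball s₀ ρ, ‖S (n + 1) s - S n s‖ ≤ u n := by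
    intro s₀ hs₀
    set ρ := min (1 / 2) ((s₀.re - d) / 3) with hρ
    have hρ0 : 0 < ρ := by
      have : 0 < s₀.re - d := by linarith
      positivity
    have hρ1 : ρ ≤ 1 / 2 := min_le_left _ _
    have hρ2 : ρ ≤ (s₀.re - d) / 3 := min_le_right _ _
    have hτ : d < s₀.re - 2 * ρ := by linarith
    have hq : N * c ^ (-(s₀.re - 2 * ρ) / 2) < 1 := by
      rw [← Real.log_neg_iff (by positivity), Real.log_mul hN0.ne' (by positivity),
        Real.log_rpow hc0]
      rw [hd, div_lt_iff₀ hlogc] at hτ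
      linarith
    obtain ⟨u, hu, hun⟩ := h.exists_summable_norm_sub_le ha hc hδ hδ1 hK (‖s₀‖ + ρ)
      (hd0.trans hτ.le) (half_pos hρ0) hq
    refine ⟨ρ, hρ0, u, hu, fun n s hs => ?_⟩
    have hs' : ‖s - s₀‖ < ρ := by simpa [dist_eq_norm] using hs
    have hre := (abs_lt.1 ((Complex.abs_re_le_norm (s - s₀)).trans_lt hs'))
    rw [Complex.sub_re] at hre
    refine hun n s ?_ (by linarith [hre.1]) (by linarith [hre.2])
    have := norm_add_le s₀ (s - s₀)
    rw [add_sub_cancel] at this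
    linarith
  refine ⟨fun s => S 0 s + ∑' n, (S (n + 1) s - S n s), ?_, ?_⟩
  · intro s hs
    obtain ⟨ρ, hρ, u, hu, hun⟩ := hlocal s hs
    have hsum : Summable fun n => S (n + 1) s - S n s :=
      Summable.of_norm_bounded hu fun n => hun n s (Metric.mem_ball_self hρ)
    have := hsum.hasSum.tendsto_sum_nat.const_add (S 0 s)
    simpa [Finset.sum_range_sub (fun n => S n s)] using this
  · intro s hs
    obtain ⟨ρ, hρ, u, hu, hun⟩ := hlocal s hs
    have hdiff := Complex.differentiableOn_tsum_of_summable_norm hu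
      (fun n => ((hSdiff (n + 1)).sub (hSdiff n)).differentiableOn) Metric.isOpen_ball hun
    exact ((hSdiff 0).differentiableAt.add
      (hdiff.differentiableAt (Metric.ball_mem_nhds s hρ))).differentiableWithinAt

end IsContractingTree

theorem zeta_of_polynomial_exists_and_holomorphic
    (R : Polynomial ℝ) (N : ℕ) (hN : R.natDegree = N) (hN2 : 2 ≤ N)
    (hR0 : R.eval 0 = 0) (c : ℝ) (hc : R.derivative.eval 0 = c) (hc1 : 1 < c)
    (a : ℝ) (ha : 0 < a)
    (hinv : ∀ z : ℂ, memIcc a (Polynomial.aeval z R) → memIcc a z)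
    (z₀ : ℝ) (hz₀ : z₀ ∈ Set.Icc 0 a) :
    ∃ ζ : ℂ → ℂ,
      (∀ s : ℂ, 2 * Real.log N / Real.log c < s.re →
        Filter.Tendsto (fun n => zetaPartial R c z₀ n s) Filter.atTop (nhds (ζ s))) ∧
      DifferentiableOn ℂ ζ {s : ℂ | 2 * Real.log N / Real.log c < s.re} := by
  have hc0 : 0 < c := by linarith
  have hN0 : 0 < N := by omega
  obtain ⟨b, B, δ, K, hδ, hδ1, hK, hroots, hle, hmul, hδle⟩ :=
    exists_root_branches hN hN2 hR0 hc hc0 ha.le hinv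
  have hcard : ∀ w ∈ Set.Icc 0 a, (R - C w).roots.card = N := fun w hw => by
    rw [← (splits_sub_C_of_preimage hinv hw).1.natDegree_eq_card_roots, natDegree_sub_C, hN]
  have hlevel := splits_polyIter_sub_C (by omega) hinv hz₀
  have htree : IsContractingTree c a δ K N b B fun n => (polyIter R n - C z₀).roots :=
    { succ_eq := fun n => by
        rw [(hlevel n).2.2]
        exact Multiset.bind_congr fun w hw => hroots w ((hlevel n).2.1 w hw)
      mem_Icc := fun n => (hlevel n).2.1
      card_eq := fun n => by
        rw [← (hlevel n).1.natDegree_eq_card_roots, natDegree_sub_C, natDegree_polyIter, hN]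
      le_mul := hle
      mul_le := hmul
      le_of_mem := hδle
      card_le := fun w hw => by
        have := hcard w hw
        rw [hroots w hw, Multiset.card_cons] at this
        omega }
  obtain ⟨ζ, hζ, hζ'⟩ := htree.exists_limit ha.le hc1 hN0 hδ hδ1 hK
  refine ⟨ζ, fun s hs => (hζ s hs).congr fun n => ?_, hζ'⟩
  rw [zetaPartial, preimageRoots,
    (hlevel n).1.roots_map_of_injective (algebraMap ℝ ℂ).injective, Multiset.map_map]
  refine congrArg _ (Multiset.map_congr rfl fun w _ => ?_)
  simp [zetaTerm, hc0.ne']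
end

section
/- Let R be a polynomial with real coefficients of degree N ≥ 2 such that R(0) = 0, c := R'(0) > 1, and there exists a > 0 with the property that every complex number z with R(z) ∈ [0,a] satisfies z ∈ [0,a]. Fix z₀ ∈ [0,a] and set d_R := 2·log N / log c. Then there exist an entire function ξ : ℂ → ℂ and a function ψ holomorphic on the half-plane {s : Re(s) > 0} such that for all s with Re(s) > d_R one has ζ_{z₀,R}(s) = ξ(s)/(1 − N·c^{-s/2}) + ψ(s). In particular ζ_{z₀,R} has a meromorphic continuation to {s : Re(s) > 0}. -/
open Polynomial Filter

/-- A real polynomial `P` vanishing at `0` all of whose complex `w`-points lie in `[0, a]`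
is determined by them through a product formula. -/
theorem exists_real_level_roots (P : ℝ[X]) (hP0 : P.eval 0 = 0) {a w : ℝ} (hw : 0 < w)
    (hP : ∀ z : ℂ, aeval z P = (w : ℂ) → memIcc a z) :
    ∃ Λ : Multiset ℝ, (∀ x ∈ Λ, 0 < x ∧ x ≤ a) ∧
      ((P - C w).map (algebraMap ℝ ℂ)).roots = Λ.map (fun x : ℝ => (x : ℂ)) ∧
      (∀ τ : ℝ, 1 - P.eval τ / w = (Λ.map (fun x => 1 - τ / x)).prod) ∧
      Multiset.card Λ = P.natDegree ∧
      P.derivative.eval 0 / w = (Λ.map (fun x => x⁻¹)).sum := by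
  set q := (P - C w).map (algebraMap ℝ ℂ) with hq
  have hev : ∀ z : ℂ, q.eval z = aeval z P - w := by
    intro z
    simp [hq, eval_map_algebraMap]
  have haev : ∀ τ : ℝ, aeval (τ : ℂ) P = ((P.eval τ : ℝ) : ℂ) := by
    intro τ
    exact Polynomial.aeval_algebraMap_apply_eq_algebraMap_eval τ P
  have hq0 : q.eval 0 = -(w : ℂ) := by
    have := haev 0
    rw [hev]; simp_all
  have hqne : q ≠ 0 := by
    rintro h
    rw [h] at hq0
    simp at hq0
    exact hw.ne' hq0
  have hroot : ∀ z ∈ q.roots, ((z.re : ℝ) : ℂ) = z ∧ 0 < z.re ∧ z.re ≤ a := by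
    intro z hz
    have h1 : q.eval z = 0 := (mem_roots hqne).1 hz
    obtain ⟨him, hre⟩ := hP z (by rw [hev] at h1; exact sub_eq_zero.1 h1)
    have hz' : ((z.re : ℝ) : ℂ) = z := Complex.ext (by simp) (by simp [him])
    refine ⟨hz', lt_of_le_of_ne hre.1 ?_, hre.2⟩
    intro h0
    rw [← h0] at hz'
    rw [← hz'] at h1
    simp [hq0] at h1
    exact hw.ne' h1
  have hmap : q.roots = (q.roots.map Complex.re).map (fun x : ℝ => (x : ℂ)) := by
    rw [Multiset.map_map]
    conv_lhs => rw [← Multiset.map_id q.roots]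
    exact Multiset.map_congr rfl fun z hz => (hroot z hz).1.symm
  have hsp : q.Splits := IsAlgClosed.splits q
  have hprod : ∀ z : ℂ, q.eval z = q.leadingCoeff * (q.roots.map (fun x => z - x)).prod :=
    fun z => hsp.eval_eq_prod_roots z
  have hne : ∀ z ∈ q.roots, z ≠ 0 := by
    intro z hz h0
    have := (hroot z hz).2.1
    simp [h0] at this
  refine ⟨q.roots.map Complex.re, ?_, hmap, ?_, ?_, ?_⟩
  · intro x hx
    obtain ⟨z, hz, rfl⟩ := Multiset.mem_map.1 hx
    exact (hroot z hz).2
  · intro τ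
    have h1 : q.eval (τ : ℂ) = q.eval 0 * (q.roots.map (fun x => 1 - (τ : ℂ) / x)).prod := by
      rw [hprod, hprod, mul_assoc, ← Multiset.prod_map_mul]
      congr 2
      refine Multiset.map_congr rfl fun z hz => ?_
      have := hne z hz
      field_simp
      ring
    rw [hev, haev, hq0] at h1
    have h2 : (q.roots.map (fun x => 1 - (τ : ℂ) / x)).prod
        = ((((q.roots.map Complex.re).map (fun x => 1 - τ / x)).prod : ℝ) : ℂ) := by
      change _ = Complex.ofRealHom _
      rw [map_multiset_prod, Multiset.map_map, Multiset.map_map]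
      congr 1
      refine Multiset.map_congr rfl fun z hz => ?_
      simp [(hroot z hz).1]
    rw [h2] at h1
    have h3 : P.eval τ - w = -w * ((q.roots.map Complex.re).map (fun x => 1 - τ / x)).prod := by
      exact_mod_cast h1
    field_simp
    linarith
  · rw [Multiset.card_map, ← hsp.natDegree_eq_card_roots, hq, natDegree_map, natDegree_sub_C]
  · have h1 := hsp.eval_derivative_div_eval_of_ne_zero (x := 0) (by
      rw [hq0]; simpa using hw.ne')
    have h2 : q.derivative.eval 0 = ((P.derivative.eval 0 : ℝ) : ℂ) := by
      rw [hq, derivative_map, derivative_sub, derivative_C, sub_zero]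
      have := Polynomial.eval_map_algebraMap (P.derivative) (0:ℂ)
      rw [this]
      have := Polynomial.aeval_algebraMap_apply_eq_algebraMap_eval (A := ℂ) (0:ℝ) P.derivative
      simpa using this
    rw [h2, hq0] at h1
    have h3 : (q.roots.map (fun z => 1 / ((0:ℂ) - z))).sum
        = -((((q.roots.map Complex.re).map (fun x => x⁻¹)).sum : ℝ) : ℂ) := by
      change _ = -Complex.ofRealHom _
      rw [map_multiset_sum, Multiset.map_map, Multiset.map_map,
        ← Multiset.sum_map_neg]
      congr 1
      refine Multiset.map_congr rfl fun z hz => ?_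
      simp [(hroot z hz).1]
    rw [h3, div_neg, neg_inj] at h1
    exact_mod_cast h1

theorem memIcc_of_aeval_polyIter {R : ℝ[X]} {a : ℝ}
    (hinv : ∀ z : ℂ, memIcc a (aeval z R) → memIcc a z) (n : ℕ) :
    ∀ z : ℂ, memIcc a (aeval z (polyIter R n)) → memIcc a z := by
  induction n with
  | zero => intro z hz; simpa [polyIter] using hz
  | succ n ih =>
    intro z hz
    rw [polyIter, aeval_comp] at hz
    exact ih z (hinv _ hz)

theorem polyIter_eval_zero {R : ℝ[X]} (hR0 : R.eval 0 = 0) (n : ℕ) :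
    (polyIter R n).eval 0 = 0 := by
  induction n with
  | zero => simp [polyIter]
  | succ n ih => simp [polyIter, ih, hR0]

theorem memIcc_ofReal {a w : ℝ} (hw : w ∈ Set.Icc 0 a) : memIcc a (w : ℂ) :=
  ⟨by simp, by simpa using hw⟩

theorem natDegree_lt_derivative_eval_zero {R : ℝ[X]} (hR2 : 2 ≤ R.natDegree)
    (hR0 : R.eval 0 = 0) {a : ℝ} (ha : 0 < a)
    (hinv : ∀ z : ℂ, memIcc a (aeval z R) → memIcc a z) :
    (R.natDegree : ℝ) < R.derivative.eval 0 := by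
  obtain ⟨U, hU, -, hprod, hcard, hsum⟩ := exists_real_level_roots R hR0 ha
    (fun z hz => hinv z (by rw [hz]; exact memIcc_ofReal ⟨ha.le, le_rfl⟩))
  set N := R.natDegree with hN
  have hle : ∀ x ∈ U.map (fun x => x⁻¹), a⁻¹ ≤ x := by
    intro x hx
    obtain ⟨u, hu, rfl⟩ := Multiset.mem_map.1 hx
    exact inv_anti₀ (hU u hu).1 (hU u hu).2
  have hge : (N : ℝ) ≤ R.derivative.eval 0 := by
    have := Multiset.card_nsmul_le_sum hle
    rw [Multiset.card_map, hcard, ← hsum, nsmul_eq_mul] at this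
    field_simp at this
    exact this
  refine lt_of_le_of_ne hge fun heq => ?_
  have hall : ∀ u ∈ U, u = a := by
    by_contra! hcon
    obtain ⟨u, hu, hua⟩ := hcon
    have hlt : (U.map (fun _ => a⁻¹)).sum < (U.map (fun x => x⁻¹)).sum := by
      refine Multiset.sum_lt_sum (fun i hi => hle _ (Multiset.mem_map_of_mem _ hi)) ⟨u, hu, ?_⟩
      exact inv_strictAnti₀ (hU u hu).1 (lt_of_le_of_ne (hU u hu).2 hua)
    rw [Multiset.map_const', Multiset.sum_replicate, hcard, ← hsum, ← heq, nsmul_eq_mul] at hlt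
    rw [div_eq_mul_inv] at hlt
    exact lt_irrefl _ hlt
  have hR : R = C a - C a * (1 - C a⁻¹ * X) ^ N := by
    refine Polynomial.funext fun τ => ?_
    have h1 := hprod τ
    rw [Multiset.eq_replicate.2 ⟨hcard, hall⟩, Multiset.map_replicate,
      Multiset.prod_replicate] at h1
    simp only [eval_sub, eval_mul, eval_C, eval_pow, eval_one, eval_X]
    rw [inv_mul_eq_div, ← h1]
    field_simp
    ring
  have hN0 : N ≠ 0 := by omega
  have hζ := Complex.isPrimitiveRoot_exp N hN0
  set ζ := Complex.exp (2 * Real.pi * Complex.I / N)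
  have hac : (a : ℂ) ≠ 0 := by exact_mod_cast ha.ne'
  have hz : aeval ((a : ℂ) * (1 - ζ)) R = 0 := by
    rw [hR]
    simp only [map_sub, map_mul, map_pow, map_one, aeval_C, aeval_X, Complex.coe_algebraMap,
      Complex.ofReal_inv]
    rw [inv_mul_cancel_left₀ hac, sub_sub_cancel, hζ.pow_eq_one]
    ring
  obtain ⟨him, hre⟩ := hinv _ (by
    rw [hz]; exact_mod_cast memIcc_ofReal (w := 0) ⟨le_rfl, ha.le⟩)
  set z := (a : ℂ) * (1 - ζ) with hzdef
  have hzre : z = (z.re : ℂ) := Complex.ext (by simp) (by simp [him])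
  have hζre : ζ = ((1 - z.re / a : ℝ) : ℂ) := by
    push_cast
    rw [← hzre, hzdef]
    field_simp
    ring
  have hpow := hζ.pow_eq_one
  rw [hζre] at hpow
  have hpow' : (1 - z.re / a) ^ N = 1 := by exact_mod_cast hpow
  have h0 : 0 ≤ 1 - z.re / a := by
    rw [sub_nonneg, div_le_one ha]; exact hre.2
  have h1 := (pow_eq_one_iff_of_nonneg h0 hN0).1 hpow'
  rw [h1] at hζre
  exact hζ.ne_one (by omega) (by simpa using hζre)

/-- The rescaled iterates `t ↦ S^{∘n}(t / cⁿ)`. -/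
noncomputable def scaledIter (S : ℝ → ℝ) (c : ℝ) : ℕ → ℝ → ℝ
  | 0, t => t
  | n + 1, t => S (scaledIter S c n (t / c))

theorem polyIter_eval_neg (R : ℝ[X]) (c : ℝ) (n : ℕ) (t : ℝ) :
    (polyIter R n).eval (-(t / c ^ n)) = -scaledIter (fun y => -R.eval (-y)) c n t := by
  induction n generalizing t with
  | zero => simp [polyIter, scaledIter]
  | succ n ih =>
    rw [polyIter, eval_comp, scaledIter, ← ih, pow_succ', ← div_div]
    simp

/-- The properties of `S(y) = -R(-y)` on the nonnegative half line which drive the iteration. -/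
structure ExpandingMap (S : ℝ → ℝ) (c a : ℝ) : Prop where
  one_lt : 1 < c
  pos : 0 < a
  cont : Continuous S
  mono : MonotoneOn S (Set.Ici 0)
  lower : ∀ y, 0 ≤ y → c * y ≤ S y
  upper : ∀ y, 0 ≤ y → c * y < a → S y ≤ c * y / (1 - c * y / a)

section ExpandingMap

variable {S : ℝ → ℝ} {c a : ℝ}

theorem ExpandingMap.of_prod {U : Multiset ℝ} (hc : 1 < c) (ha : 0 < a) (hS : Continuous S)
    (hU : ∀ u ∈ U, 0 < u) (hprod : ∀ y, 1 + S y / a = (U.map (fun u => 1 + y / u)).prod)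
    (hsum : c / a = (U.map (fun u => u⁻¹)).sum) : ExpandingMap S c a where
  one_lt := hc
  pos := ha
  cont := hS
  mono := by
    intro x hx y hy hxy
    have h : 1 + S x / a ≤ 1 + S y / a := by
      rw [hprod, hprod]
      refine Multiset.prod_map_le_prod_map₀ _ _ (fun u hu => ?_) (fun u hu => ?_)
      · have : 0 ≤ x / u := div_nonneg hx (hU u hu).le
        linarith
      · have := hU u hu
        gcongr
    have h2 : S x / a ≤ S y / a := by linarith
    exact (div_le_div_iff_of_pos_right ha).1 h2
  lower := by
    intro y hy
    have key : ∀ V : Multiset ℝ, (∀ u ∈ V, 0 < u) →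
        1 + y * (V.map (fun u => u⁻¹)).sum ≤ (V.map (fun u => 1 + y / u)).prod := by
      intro V
      induction V using Multiset.induction_on with
      | empty => intro _; simp
      | cons u V ih =>
        intro hV
        have h1 := ih fun v hv => hV v (Multiset.mem_cons_of_mem hv)
        have hu := hV u (Multiset.mem_cons_self u V)
        have h2 : 0 ≤ (V.map (fun u => u⁻¹)).sum := Multiset.sum_nonneg fun x hx => by
          obtain ⟨v, hv, rfl⟩ := Multiset.mem_map.1 hx
          exact (inv_pos.2 (hV v (Multiset.mem_cons_of_mem hv))).le
        simp only [Multiset.map_cons, Multiset.prod_cons, Multiset.sum_cons]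
        have h3 : 0 ≤ y / u := div_nonneg hy hu.le
        calc 1 + y * (u⁻¹ + (V.map (fun u => u⁻¹)).sum)
            ≤ (1 + y / u) * (1 + y * (V.map (fun u => u⁻¹)).sum) := by
              have : 0 ≤ (y / u) * (y * (V.map (fun u => u⁻¹)).sum) := by positivity
              rw [div_eq_mul_inv] at this ⊢
              linarith
          _ ≤ _ := by gcongr
    have h := key U hU
    rw [← hsum, ← hprod] at h
    field_simp at h
    linarith
  upper := by
    intro y hy hya
    have h1 : (U.map (fun u => 1 + y / u)).prod ≤ (U.map (fun u => Real.exp (y / u))).prod := by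
      refine Multiset.prod_map_le_prod_map₀ _ _ (fun u hu => ?_) (fun u hu => ?_)
      · have := div_nonneg hy (hU u hu).le
        linarith
      · rw [add_comm]; exact Real.add_one_le_exp _
    have h2 : (U.map (fun u => Real.exp (y / u))).prod = Real.exp (c * y / a) := by
      have : c * y / a = (U.map (fun u => y / u)).sum := by
        rw [mul_div_right_comm, hsum, mul_comm, ← Multiset.sum_map_mul_left]
        simp only [div_eq_mul_inv]
      rw [this, Real.exp_multiset_sum, Multiset.map_map]
      rfl
    have h3 : Real.exp (c * y / a) ≤ 1 / (1 - c * y / a) := by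
      have hpos : 0 < 1 - c * y / a := by rw [sub_pos, div_lt_one ha]; exact hya
      rw [le_div_iff₀ hpos]
      have h4 := Real.add_one_le_exp (-(c * y / a))
      calc Real.exp (c * y / a) * (1 - c * y / a)
          ≤ Real.exp (c * y / a) * Real.exp (-(c * y / a)) := by gcongr; linarith
        _ = 1 := by rw [← Real.exp_add]; simp
    have hpos : 0 < a - c * y := by linarith
    have h5 := (hprod y).le.trans (h1.trans (h2.le.trans h3))
    have e1 : 1 / (1 - c * y / a) = a / (a - c * y) := by field_simp
    have e2 : c * y / (1 - c * y / a) = a * (a / (a - c * y) - 1) := by field_simp; ring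
    rw [e1] at h5
    rw [e2]
    have : S y / a ≤ a / (a - c * y) - 1 := by linarith
    rw [div_le_iff₀ ha] at this
    linarith

namespace ExpandingMap

theorem continuous_scaledIter (h : ExpandingMap S c a) (n : ℕ) :
    Continuous (scaledIter S c n) := by
  induction n with
  | zero => exact continuous_id
  | succ n ih => exact h.cont.comp (ih.comp (continuous_id.div_const c))

theorem nonneg (h : ExpandingMap S c a) {y : ℝ} (hy : 0 ≤ y) : 0 ≤ S y :=
  le_trans (mul_nonneg (by linarith [h.one_lt]) hy) (h.lower y hy)

theorem scaledIter_nonneg (h : ExpandingMap S c a) (n : ℕ) {t : ℝ} (ht : 0 ≤ t) :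
    0 ≤ scaledIter S c n t := by
  have hc := h.one_lt
  induction n generalizing t with
  | zero => exact ht
  | succ n ih => exact h.nonneg (ih (by positivity))

theorem scaledIter_monotoneOn (h : ExpandingMap S c a) (n : ℕ) :
    MonotoneOn (scaledIter S c n) (Set.Ici 0) := by
  have hc := h.one_lt
  induction n with
  | zero => exact fun x _ y _ hxy => hxy
  | succ n ih =>
    intro x hx y hy hxy
    have hx' : 0 ≤ x / c := div_nonneg hx (by linarith)
    have hy' : 0 ≤ y / c := div_nonneg hy (by linarith)
    exact h.mono (h.scaledIter_nonneg n hx') (h.scaledIter_nonneg n hy')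
      (ih hx' hy' (by gcongr))

theorem scaledIter_le_succ (h : ExpandingMap S c a) (n : ℕ) {t : ℝ} (ht : 0 ≤ t) :
    scaledIter S c n t ≤ scaledIter S c (n + 1) t := by
  have hc := h.one_lt
  induction n generalizing t with
  | zero =>
    have := h.lower (t / c) (by positivity)
    rwa [mul_div_cancel₀ _ (by positivity)] at this
  | succ n ih =>
    have ht' : 0 ≤ t / c := by positivity
    exact h.mono (h.scaledIter_nonneg n ht') (h.scaledIter_nonneg (n + 1) ht') (ih ht')

theorem scaledIter_le (h : ExpandingMap S c a) (n : ℕ) {t : ℝ} (ht : 0 ≤ t)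
    (hta : c / (c - 1) * (t / a) < 1) :
    scaledIter S c n t ≤ t / (1 - c / (c - 1) * (t / a)) := by
  have hc := h.one_lt
  have ha := h.pos
  have hc1 : 0 < c - 1 := by linarith
  induction n generalizing t with
  | zero =>
    have h0 : 0 ≤ c / (c - 1) * (t / a) := by positivity
    exact le_div_self ht (by linarith) (by linarith)
  | succ n ih =>
    have ht' : 0 ≤ t / c := by positivity
    have hta0 : c * t < (c - 1) * a := by
      have e : c / (c - 1) * (t / a) = c * t / ((c - 1) * a) := by field_simp
      rw [e, div_lt_one (by positivity)] at hta
      exact hta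
    have htlt : t < (c - 1) * a := by nlinarith
    have hd1 : 0 < (c - 1) * a - t := by linarith
    have hd2 : 0 < (c - 1) * a - c * t := by linarith
    have hlt : c / (c - 1) * (t / c / a) < 1 := by
      have e : c / (c - 1) * (t / c / a) = t / ((c - 1) * a) := by field_simp
      rw [e, div_lt_one (by positivity)]
      exact htlt
    have h1 := ih ht' hlt
    have e1 : t / c / (1 - c / (c - 1) * (t / c / a)) = (c - 1) * a * t / (c * ((c - 1) * a - t)) := by
      have : 1 - c / (c - 1) * (t / c / a) = ((c - 1) * a - t) / ((c - 1) * a) := by field_simp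
      rw [this]
      field_simp
    have e2 : t / (1 - c / (c - 1) * (t / a)) = (c - 1) * a * t / ((c - 1) * a - c * t) := by
      have : 1 - c / (c - 1) * (t / a) = ((c - 1) * a - c * t) / ((c - 1) * a) := by field_simp
      rw [this]
      field_simp
    rw [e1] at h1
    set Y := (c - 1) * a * t / (c * ((c - 1) * a - t)) with hY
    have hY0 : 0 ≤ Y := by positivity
    have hcY : c * Y = (c - 1) * a * t / ((c - 1) * a - t) := by rw [hY]; field_simp
    have hcYa : c * Y < a := by
      rw [hcY, div_lt_iff₀ hd1]
      nlinarith
    calc scaledIter S c (n + 1) t ≤ S Y :=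
          h.mono (h.scaledIter_nonneg n ht') hY0 h1
      _ ≤ c * Y / (1 - c * Y / a) := h.upper Y hY0 hcYa
      _ = _ := by
        rw [e2, hcY]
        have : 1 - (c - 1) * a * t / ((c - 1) * a - t) / a
            = ((c - 1) * a - c * t) / ((c - 1) * a - t) := by
          field_simp
          ring
        rw [this]
        field_simp

/-- The rescaled iterates increase to a limit which linearizes `S`. -/
theorem exists_limit (h : ExpandingMap S c a) :
    ∃ y : ℝ → ℝ, Measurable y ∧
      (∀ t, 0 ≤ t → Tendsto (fun n => scaledIter S c n t) atTop (nhds (y t))) ∧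
      (∀ t, 0 ≤ t → ∀ n, scaledIter S c n t ≤ y t) ∧
      MonotoneOn y (Set.Ici 0) ∧
      (∀ t, 0 ≤ t → y (c * t) = S (y t)) ∧
      ∃ t₀ > 0, ∀ t, 0 ≤ t → t ≤ t₀ → y t ≤ 2 * t := by
  have hc := h.one_lt
  have hc0 : 0 < c := by linarith
  have ha := h.pos
  have hc1 : 0 < c - 1 := by linarith
  have hsucc : ∀ n t, scaledIter S c (n + 1) (c * t) = S (scaledIter S c n t) := by
    intro n t
    rw [scaledIter, mul_div_cancel_left₀ _ hc0.ne']
  have hmono : ∀ t, 0 ≤ t → Monotone fun n => scaledIter S c n t := fun t ht =>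
    monotone_nat_of_le_succ fun n => h.scaledIter_le_succ n ht
  obtain ⟨t₀, ht₀, hκ⟩ : ∃ t₀ > 0, c / (c - 1) * (t₀ / a) = 1 / 2 :=
    ⟨(c - 1) * a / (2 * c), by positivity, by field_simp⟩
  have hsmall : ∀ t, 0 ≤ t → t ≤ t₀ → ∀ n, scaledIter S c n t ≤ 2 * t := by
    intro t ht htt n
    have hκt : c / (c - 1) * (t / a) ≤ 1 / 2 := by
      rw [← hκ]
      gcongr
    refine (h.scaledIter_le n ht (by linarith)).trans ?_
    rw [div_le_iff₀ (by linarith)]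
    nlinarith
  have hbdd : ∀ m : ℕ, ∀ t, 0 ≤ t → t ≤ c ^ m * t₀ → ∃ B, ∀ n, scaledIter S c n t ≤ B := by
    intro m
    induction m with
    | zero => exact fun t ht htt => ⟨2 * t, hsmall t ht (by simpa using htt)⟩
    | succ m ih =>
      intro t ht htt
      have ht' : 0 ≤ t / c := by positivity
      obtain ⟨B, hB⟩ := ih (t / c) ht' (by
        rw [div_le_iff₀ hc0]
        calc t ≤ c ^ (m + 1) * t₀ := htt
          _ = c ^ m * t₀ * c := by ring)
      refine ⟨S B, fun n => (h.scaledIter_le_succ n ht).trans ?_⟩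
      exact h.mono (h.scaledIter_nonneg n ht') ((h.scaledIter_nonneg 0 ht').trans (hB 0)) (hB n)
  have hlim : ∀ t, 0 ≤ t → ∃ l, Tendsto (fun n => scaledIter S c n t) atTop (nhds l) := by
    intro t ht
    obtain ⟨m, hm⟩ := pow_unbounded_of_one_lt (t / t₀) hc
    obtain ⟨B, hB⟩ := hbdd m t ht (by rw [← div_le_iff₀ ht₀]; exact hm.le)
    exact ⟨_, tendsto_atTop_ciSup (hmono t ht) ⟨B, by rintro _ ⟨n, rfl⟩; exact hB n⟩⟩
  have hlim' : ∀ t, ∃ l, Tendsto (fun n => scaledIter S c n (max t 0)) atTop (nhds l) :=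
    fun t => hlim _ (le_max_right _ _)
  choose y hy using hlim'
  have hy' : ∀ t, 0 ≤ t → Tendsto (fun n => scaledIter S c n t) atTop (nhds (y t)) := by
    intro t ht
    have := hy t
    rwa [max_eq_left ht] at this
  refine ⟨y, ?_, hy', ?_, ?_, ?_, t₀, ht₀, ?_⟩
  · refine measurable_of_tendsto_metrizable
      (f := fun n t => scaledIter S c n (max t 0)) (fun n => ?_) (tendsto_pi_nhds.2 hy)
    exact ((h.continuous_scaledIter n).comp (continuous_id.max continuous_const)).measurable
  · exact fun t ht n => (hmono t ht).ge_of_tendsto (hy' t ht) n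
  · exact fun s hs t ht hst => le_of_tendsto_of_tendsto' (hy' s hs) (hy' t ht) fun n =>
      h.scaledIter_monotoneOn n hs ht hst
  · intro t ht
    have h1 := (tendsto_add_atTop_iff_nat 1).2 (hy' (c * t) (by positivity))
    simp only [hsucc] at h1
    exact tendsto_nhds_unique h1 ((h.cont.tendsto _).comp (hy' t ht))
  · exact fun t ht htt => le_of_tendsto' (hy' t ht) (hsmall t ht htt)

end ExpandingMap

end ExpandingMap

theorem abs_log_one_add_div_sub_le {u v y : ℝ} (hu : 0 < u) (hv : 0 < v) (hy : 0 ≤ y) :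
    |Real.log (1 + y / u) - Real.log (1 + y / v)| ≤ |Real.log u - Real.log v| := by
  wlog huv : u ≤ v generalizing u v
  · rw [abs_sub_comm, abs_sub_comm (Real.log u)]
    exact this hv hu (le_of_not_ge huv)
  have h1 : Real.log (1 + y / v) ≤ Real.log (1 + y / u) := by
    apply Real.log_le_log (by positivity)
    gcongr
  have h2 : Real.log u ≤ Real.log v := Real.log_le_log hu huv
  rw [abs_of_nonneg (by linarith), abs_of_nonpos (by linarith)]
  have h3 : Real.log (u * (1 + y / u)) ≤ Real.log (v * (1 + y / v)) := by
    apply Real.log_le_log (by positivity)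
    rw [mul_add, mul_add, mul_div_cancel₀ _ hu.ne', mul_div_cancel₀ _ hv.ne']
    linarith
  rw [Real.log_mul hu.ne' (by positivity), Real.log_mul hv.ne' (by positivity)] at h3
  linarith

theorem exists_abs_log_sub_card_mul_log_le {S : ℝ → ℝ} {a z₀ : ℝ} {U : Multiset ℝ} (ha : 0 < a)
    (hz₀ : 0 < z₀) (hU : ∀ u ∈ U, 0 < u) (hS : ∀ y, 0 ≤ y → 0 ≤ S y)
    (hprod : ∀ y, 1 + S y / a = (U.map (fun u => 1 + y / u)).prod) :
    ∃ A, ∀ y, 0 ≤ y →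
      |Real.log (1 + S y / z₀) - Multiset.card U * Real.log (1 + y / z₀)| ≤ A := by
  refine ⟨|Real.log z₀ - Real.log a| + (U.map (fun u => |Real.log u - Real.log z₀|)).sum,
    fun y hy => ?_⟩
  have h1 := abs_log_one_add_div_sub_le hz₀ ha (hS y hy)
  have h2 : Real.log (1 + S y / a) - Multiset.card U * Real.log (1 + y / z₀)
      = (U.map (fun u => Real.log (1 + y / u) - Real.log (1 + y / z₀))).sum := by
    rw [hprod, Real.log_multiset_prod, Multiset.map_map, Multiset.sum_map_sub]
    · simp
    · intro x hx
      obtain ⟨u, hu, rfl⟩ := Multiset.mem_map.1 hx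
      have := hU u hu
      positivity
  have h3 : |(U.map (fun u => Real.log (1 + y / u) - Real.log (1 + y / z₀))).sum|
      ≤ (U.map (fun u => |Real.log u - Real.log z₀|)).sum := by
    refine (Multiset.abs_sum_le_sum_abs).trans ?_
    rw [Multiset.map_map]
    exact Multiset.sum_map_le_sum_map _ _ fun u hu => abs_log_one_add_div_sub_le (hU u hu) hz₀ hy
  rw [← h2] at h3
  calc _ ≤ _ := abs_sub_le _ (Real.log (1 + S y / a)) _
    _ ≤ _ := add_le_add h1 h3

open MeasureTheory in
theorem hasMellin_inv_one_add {σ : ℂ} (h0 : 0 < σ.re) (h1 : σ.re < 1) :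
    HasMellin (fun t : ℝ => ((1 + t : ℝ) : ℂ)⁻¹) (1 - σ) (Real.pi / Complex.sin (Real.pi * σ)) := by
  set f : ℝ → ℝ := fun u => (1 + u)⁻¹
  set g : ℝ → ℂ := fun x => (x : ℂ) ^ (σ - 1) * (1 - (x : ℂ)) ^ ((1 - σ) - 1)
  have hderiv : ∀ u ∈ Set.Ioi (0 : ℝ), HasDerivWithinAt f (-1 / (1 + u) ^ 2) (Set.Ioi 0) u := by
    intro u hu
    have hu' : (0 : ℝ) < u := hu
    exact (((hasDerivAt_id u).const_add 1).inv (by simp; positivity)).hasDerivWithinAt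
  have hinj : Set.InjOn f (Set.Ioi 0) := by
    intro u _ v _ huv
    have := inv_injective huv
    linarith
  have himg : f '' Set.Ioi 0 = Set.Ioo 0 1 := by
    ext x
    constructor
    · rintro ⟨u, hu, rfl⟩
      have hu' : (0 : ℝ) < u := hu
      exact ⟨by positivity, inv_lt_one_of_one_lt₀ (by linarith)⟩
    · rintro ⟨hx0, hx1⟩
      refine ⟨x⁻¹ - 1, ?_, by simp [f]⟩
      have := (one_lt_inv₀ hx0).2 hx1
      simp only [Set.mem_Ioi]; linarith
  have hcongr : ∀ u ∈ Set.Ioi (0 : ℝ), |(-1 / (1 + u) ^ 2 : ℝ)| • g (f u)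
      = (u : ℂ) ^ ((1 - σ) - 1) • ((1 + u : ℝ) : ℂ)⁻¹ := by
    intro u hu
    have hu' : (0 : ℝ) < u := hu
    have hp : (0 : ℝ) < 1 + u := by linarith
    have hpc : ((1 + u : ℝ) : ℂ) ≠ 0 := by exact_mod_cast hp.ne'
    have e1 : (1 : ℂ) - ((f u : ℝ) : ℂ) = ((u * (1 + u)⁻¹ : ℝ) : ℂ) := by
      rw [← Complex.ofReal_one, ← Complex.ofReal_sub]
      congr 1
      simp only [f]
      field_simp
      ring
    have e2 : |(-1 / (1 + u) ^ 2 : ℝ)| = (1 + u)⁻¹ ^ 2 := by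
      rw [neg_div, abs_neg, abs_of_pos (by positivity)]
      field_simp
    have e3 : (((1 + u)⁻¹ : ℝ) : ℂ) ^ (σ - 1) * (((1 + u)⁻¹ : ℝ) : ℂ) ^ ((1 - σ) - 1)
        = ((1 + u : ℝ) : ℂ) := by
      rw [← Complex.cpow_add _ _ (by exact_mod_cast (inv_pos.2 hp).ne')]
      rw [show σ - 1 + (1 - σ - 1) = -1 by ring, Complex.cpow_neg_one]
      push_cast
      rw [inv_inv]
    simp only [g, e1, e2]
    rw [Complex.ofReal_mul, Complex.mul_cpow_ofReal_nonneg hu'.le (inv_pos.2 hp).le,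
      Complex.real_smul, smul_eq_mul]
    calc _ = (((1 + u)⁻¹ ^ 2 : ℝ) : ℂ) * (((((1 + u)⁻¹ : ℝ) : ℂ) ^ (σ - 1) *
            (((1 + u)⁻¹ : ℝ) : ℂ) ^ ((1 - σ) - 1)) * (u : ℂ) ^ ((1 - σ) - 1)) := by
          simp only [f]; ring
      _ = _ := by
          rw [e3]
          push_cast at hpc ⊢
          field_simp
  have hs : 0 < (1 - σ).re := by simpa using h1
  have h_int : IntegrableOn g (Set.Ioo 0 1) := by
    have := Complex.betaIntegral_convergent h0 hs
    rw [intervalIntegrable_iff_integrableOn_Ioc_of_le zero_le_one] at this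
    exact this.mono_set Set.Ioo_subset_Ioc_self
  constructor
  · rw [← himg, integrableOn_image_iff_integrableOn_abs_deriv_smul measurableSet_Ioi hderiv hinj]
      at h_int
    exact (integrableOn_congr_fun hcongr measurableSet_Ioi).1 h_int
  · rw [mellin, ← setIntegral_congr_fun measurableSet_Ioi hcongr,
      ← integral_image_eq_integral_abs_deriv_smul measurableSet_Ioi hderiv hinj, himg,
      ← integral_Ioc_eq_integral_Ioo, ← intervalIntegral.integral_of_le zero_le_one]
    have h2 := Complex.Gamma_mul_Gamma_eq_betaIntegral h0 hs
    rw [Complex.Gamma_mul_Gamma_one_sub, add_sub_cancel, Complex.Gamma_one, one_mul] at h2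
    rw [h2, Complex.betaIntegral]

theorem log_one_add_le_rpow {ε t : ℝ} (hε : 0 < ε) (ht : 1 ≤ t) :
    Real.log (1 + t) ≤ 2 ^ ε / ε * t ^ ε := by
  have h1 := Real.log_le_rpow_div (x := 1 + t) (by linarith) hε
  refine h1.trans ?_
  rw [div_mul_eq_mul_div, ← Real.mul_rpow (by norm_num) (by linarith)]
  gcongr
  linarith

theorem log_one_add_le {t : ℝ} (ht : 0 ≤ t) : Real.log (1 + t) ≤ t := by
  have := Real.log_le_sub_one_of_pos (x := 1 + t) (by linarith)
  linarith

theorem mellinConvergent_log_one_add {σ : ℂ} (h0 : 0 < σ.re) (h1 : σ.re < 1) :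
    MellinConvergent (fun t : ℝ => (Real.log (1 + t) : ℂ)) (-σ) := by
  refine mellinConvergent_of_isBigO_rpow (a := -(σ.re / 2)) (b := -1) ?_ ?_ (by simp; linarith)
    ?_ (by simp; linarith)
  · refine ContinuousOn.locallyIntegrableOn ?_ measurableSet_Ioi
    refine Complex.continuous_ofReal.comp_continuousOn ?_
    refine ContinuousOn.log (by fun_prop) fun t ht => ?_
    have : (0 : ℝ) < t := ht
    positivity
  · refine Asymptotics.IsBigO.of_bound (2 ^ (σ.re / 2) / (σ.re / 2)) ?_
    filter_upwards [eventually_ge_atTop 1] with t ht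
    have ht0 : (0 : ℝ) ≤ t := by linarith
    rw [Complex.norm_real, neg_neg, Real.norm_of_nonneg (Real.log_nonneg (by linarith)),
      Real.norm_of_nonneg (by positivity)]
    exact log_one_add_le_rpow (by linarith) ht
  · refine Asymptotics.IsBigO.of_bound 1 ?_
    filter_upwards [self_mem_nhdsWithin] with t ht
    have ht0 : (0 : ℝ) < t := ht
    rw [Complex.norm_real, neg_neg, Real.norm_of_nonneg (Real.log_nonneg (by linarith)),
      Real.norm_of_nonneg (by positivity), Real.rpow_one, one_mul]
    exact log_one_add_le ht0.le

open MeasureTheory in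
/-- The Mellin transform of `log (1 + t)`. -/
theorem hasMellin_log_one_add {σ : ℂ} (h0 : 0 < σ.re) (h1 : σ.re < 1) :
    HasMellin (fun t : ℝ => (Real.log (1 + t) : ℂ)) (-σ)
      (Real.pi / (σ * Complex.sin (Real.pi * σ))) := by
  have hconv := mellinConvergent_log_one_add h0 h1
  have hσ : σ ≠ 0 := by rintro rfl; simp at h0
  obtain ⟨hconv', hval⟩ := hasMellin_inv_one_add h0 h1
  refine ⟨hconv, ?_⟩
  set G : ℝ → ℂ := fun t => (Real.log (1 + t) : ℂ) * (t : ℂ) ^ (-σ) with hG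
  have hnorm : ∀ t : ℝ, 0 < t → ‖G t‖ = Real.log (1 + t) * t ^ (-σ.re) := by
    intro t ht
    rw [hG, norm_mul, Complex.norm_real, Complex.norm_cpow_eq_rpow_re_of_pos ht,
      Real.norm_of_nonneg (Real.log_nonneg (by linarith)), Complex.neg_re]
  have hG0 : G 0 = 0 := by simp [hG]
  have hderiv : ∀ t ∈ Set.Ioi (0 : ℝ), HasDerivAt G
      ((t : ℂ) ^ ((1 - σ) - 1) • ((1 + t : ℝ) : ℂ)⁻¹
        - σ * ((t : ℂ) ^ (-σ - 1) • (Real.log (1 + t) : ℂ))) t := by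
    intro t ht
    have ht0 : (0 : ℝ) < t := ht
    have d1 : HasDerivAt (fun t : ℝ => (Real.log (1 + t) : ℂ)) (((1 + t : ℝ) : ℂ)⁻¹) t := by
      have := (((hasDerivAt_id t).const_add 1).log (by simp; positivity)).ofReal_comp
      simpa using this
    have d2 : HasDerivAt (fun t : ℝ => (t : ℂ) ^ (-σ)) (-σ * (t : ℂ) ^ (-σ - 1)) t :=
      hasDerivAt_ofReal_cpow_const ht0.ne' (by simpa using hσ)
    refine (d1.mul d2).congr_deriv ?_
    rw [show (1 - σ) - 1 = -σ by ring, smul_eq_mul, smul_eq_mul]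
    ring
  have hcont : ContinuousWithinAt G (Set.Ici 0) 0 := by
    rw [ContinuousWithinAt, hG0]
    refine squeeze_zero_norm' (a := fun t : ℝ => t ^ (1 - σ.re)) ?_ ?_
    · filter_upwards [self_mem_nhdsWithin] with t ht
      rcases eq_or_lt_of_le (show (0 : ℝ) ≤ t from ht) with rfl | ht0
      · rw [hG0, norm_zero]; positivity
      · rw [hnorm t ht0, sub_eq_add_neg, Real.rpow_add ht0, Real.rpow_one]
        gcongr
        exact log_one_add_le ht0.le
    · have : ContinuousAt (fun t : ℝ => t ^ (1 - σ.re)) 0 :=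
        Real.continuousAt_rpow_const _ _ (Or.inr (by linarith))
      have h2 := this.tendsto
      rw [Real.zero_rpow (by linarith)] at h2
      exact h2.mono_left nhdsWithin_le_nhds
  have htop : Tendsto G atTop (nhds 0) := by
    refine squeeze_zero_norm' (a := fun t : ℝ => 2 ^ (σ.re / 2) / (σ.re / 2) * t ^ (-(σ.re / 2)))
      ?_ ?_
    · filter_upwards [eventually_ge_atTop 1] with t ht
      have ht0 : (0 : ℝ) < t := by linarith
      rw [hnorm t ht0]
      calc _ ≤ (2 ^ (σ.re / 2) / (σ.re / 2) * t ^ (σ.re / 2)) * t ^ (-σ.re) := by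
            gcongr
            exact log_one_add_le_rpow (by linarith) ht
        _ = _ := by
            rw [mul_assoc, ← Real.rpow_add ht0]
            congr 2
            ring
    · have := (tendsto_rpow_neg_atTop (y := σ.re / 2) (by linarith)).const_mul
        (2 ^ (σ.re / 2) / (σ.re / 2))
      simpa using this
  have hI := integral_Ioi_of_hasDerivAt_of_tendsto hcont hderiv
    (hconv'.sub (hconv.const_mul σ)) htop
  rw [integral_sub hconv' (hconv.const_mul σ), integral_const_mul, hG0, sub_zero] at hI
  change mellin _ _ - σ * mellin _ _ = 0 at hI
  rw [hval] at hI
  rw [← div_div, div_right_comm, eq_div_iff hσ, mul_comm]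
  exact (sub_eq_zero.1 hI).symm

open MeasureTheory in
theorem mellin_of_rpow_bounds {f : ℝ → ℂ} (hf : Measurable f) {C p q : ℝ}
    (h0 : ∀ t, 0 < t → t ≤ 1 → ‖f t‖ ≤ C * t ^ p) (h1 : ∀ t, 1 < t → ‖f t‖ ≤ C * t ^ q) {w : ℂ}
    (hp : -p < w.re) (hq : w.re < -q) :
    MellinConvergent f w ∧ DifferentiableAt ℂ (mellin f) w := by
  have hbound : ∀ t ∈ Set.Ioi (0 : ℝ), ‖f t‖ ≤ |C| * t ^ p + |C| * t ^ q := by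
    intro t ht
    have ht0 : (0 : ℝ) < t := ht
    have e1 : 0 ≤ |C| * t ^ p := by positivity
    have e2 : 0 ≤ |C| * t ^ q := by positivity
    rcases le_or_gt t 1 with h | h
    · have : C * t ^ p ≤ |C| * t ^ p := by gcongr; exact le_abs_self C
      linarith [h0 t ht0 h]
    · have : C * t ^ q ≤ |C| * t ^ q := by gcongr; exact le_abs_self C
      linarith [h1 t h]
  have hloc : LocallyIntegrableOn f (Set.Ioi 0) := by
    have hg : LocallyIntegrableOn (fun t : ℝ => |C| * t ^ p + |C| * t ^ q) (Set.Ioi 0) := by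
      refine ContinuousOn.locallyIntegrableOn ?_ measurableSet_Ioi
      intro t ht
      have ht0 : (0 : ℝ) < t := ht
      exact (((Real.continuousAt_rpow_const t p (Or.inl ht0.ne')).const_mul _).add
        ((Real.continuousAt_rpow_const t q (Or.inl ht0.ne')).const_mul _)).continuousWithinAt
    intro t ht
    obtain ⟨u, hu, h_int⟩ := hg t ht
    have ht0 : Set.Ioi (0 : ℝ) ∈ nhdsWithin t (Set.Ioi 0) := self_mem_nhdsWithin
    refine ⟨u ∩ Set.Ioi 0, inter_mem hu ht0, ?_⟩
    refine Integrable.mono' (h_int.mono_set Set.inter_subset_left) hf.aestronglyMeasurable ?_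
    refine ae_restrict_of_ae_restrict_of_subset Set.inter_subset_right ?_
    exact (ae_restrict_iff' measurableSet_Ioi).2 (Eventually.of_forall hbound)
  have htop : f =O[atTop] fun t : ℝ => t ^ (-(-q)) := by
    refine Asymptotics.IsBigO.of_bound C ?_
    filter_upwards [eventually_gt_atTop 1] with t ht
    rw [neg_neg, Real.norm_of_nonneg (Real.rpow_nonneg (by linarith) _)]
    exact h1 t ht
  have hbot : f =O[nhdsWithin 0 (Set.Ioi 0)] fun t : ℝ => t ^ (-(-p)) := by
    refine Asymptotics.IsBigO.of_bound C ?_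
    have : Set.Ioc (0 : ℝ) 1 ∈ nhdsWithin 0 (Set.Ioi 0) := Ioc_mem_nhdsGT one_pos
    filter_upwards [this] with t ht
    rw [neg_neg, Real.norm_of_nonneg (Real.rpow_nonneg ht.1.le _)]
    exact h0 t ht.1 ht.2
  exact ⟨mellinConvergent_of_isBigO_rpow hloc htop hq hbot hp,
    mellin_differentiableAt_of_isBigO_rpow hloc htop hq hbot hp⟩

/-- A nonnegative function which vanishes linearly at `0` and is multiplied by `N`, up to a bounded
error, when its argument is multiplied by `c`. -/
structure QuasiHomogeneous (H : ℝ → ℝ) (c N A : ℝ) : Prop where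
  meas : Measurable H
  one_lt : 1 < N
  lt : N < c
  nonneg : ∀ t, 0 < t → 0 ≤ H t
  le_linear : ∀ t, 0 < t → t ≤ 1 → H t ≤ A * t
  le_const : ∀ t, 1 ≤ t → t ≤ c → H t ≤ A
  quasi : ∀ t, 0 < t → |H (c * t) - N * H t| ≤ A

/-- For `Re s > 2 log N / log c` the number `N c^{-s/2}` lies in the unit disc. -/
theorem norm_mul_cpow_lt_one {c N : ℝ} (hc : 1 < c) (hN : 0 < N) {s : ℂ}
    (hs : 2 * Real.log N / Real.log c < s.re) : ‖(N : ℂ) * (c : ℂ) ^ (-s / 2)‖ < 1 := by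
  have hc0 : 0 < c := by linarith
  have hlog := Real.log_pos hc
  rw [norm_mul, Complex.norm_real, Complex.norm_cpow_eq_rpow_re_of_pos hc0,
    Real.norm_of_nonneg hN.le]
  have hre : (-s / 2).re = -(s.re / 2) := by
    simp [neg_div]
  rw [hre, Real.rpow_neg hc0.le, ← div_eq_mul_inv, div_lt_one (by positivity),
    ← Real.log_lt_log_iff hN (by positivity), Real.log_rpow hc0]
  rw [div_lt_iff₀ hlog] at hs
  linarith

theorem one_sub_mul_cpow_ne_zero {c N : ℝ} (hc : 1 < c) (hN : 0 < N) {s : ℂ}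
    (hs : 2 * Real.log N / Real.log c < s.re) : 1 - (N : ℂ) * (c : ℂ) ^ (-s / 2) ≠ 0 := by
  intro h
  have h1 := norm_mul_cpow_lt_one hc hN hs
  rw [← sub_eq_zero.1 h] at h1
  simp at h1

namespace QuasiHomogeneous

variable {H : ℝ → ℝ} {c N A : ℝ}

theorem bound_nonneg (h : QuasiHomogeneous H c N A) : 0 ≤ A :=
  (abs_nonneg _).trans (h.quasi 1 one_pos)

/-- A quasi-homogeneous function is at bounded distance from a homogeneous one. -/
theorem exists_homogeneous (h : QuasiHomogeneous H c N A) :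
    ∃ (F : ℝ → ℝ) (B : ℝ), 0 ≤ B ∧ Measurable F ∧ (∀ t, 0 < t → F (c * t) = N * F t) ∧
      (∀ t, 0 < t → |H t - F t| ≤ B) ∧
      ∀ t, 1 ≤ t → |F t| ≤ B * t ^ (Real.log N / Real.log c) := by
  have hN1 := h.one_lt
  have hN0 : 0 < N := by linarith
  have hc1 : 1 < c := h.one_lt.trans h.lt
  have hc0 : 0 < c := by linarith
  have hA := h.bound_nonneg
  set a : ℕ → ℝ → ℝ := fun m t => (N⁻¹) ^ m * H (c ^ m * t) with ha
  have hstep : ∀ t, 0 < t → ∀ m, dist (a m t) (a (m + 1) t) ≤ A * (N⁻¹) ^ m := by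
    intro t ht m
    have h1 := h.quasi (c ^ m * t) (by positivity)
    have e : a (m + 1) t - a m t
        = (N⁻¹) ^ m * N⁻¹ * (H (c * (c ^ m * t)) - N * H (c ^ m * t)) := by
      simp only [ha, pow_succ]
      field_simp
    rw [dist_comm, Real.dist_eq, e, abs_mul, abs_of_nonneg (by positivity)]
    have h2 : N⁻¹ ≤ 1 := inv_le_one_of_one_le₀ hN1.le
    calc _ ≤ (N⁻¹) ^ m * 1 * A := by gcongr
      _ = _ := by ring
  have hr : N⁻¹ < 1 := inv_lt_one_of_one_lt₀ hN1
  have hlim : ∀ t, ∃ l, Tendsto (fun m => if 0 < t then a m t else 0) atTop (nhds l) := by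
    intro t
    split_ifs with ht
    · exact cauchySeq_tendsto_of_complete (cauchySeq_of_le_geometric _ _ hr (hstep t ht))
    · exact ⟨0, tendsto_const_nhds⟩
  choose F hF using hlim
  have hF' : ∀ t, 0 < t → Tendsto (fun m => a m t) atTop (nhds (F t)) := by
    intro t ht
    simpa [ht] using hF t
  set B₀ := A / (1 - N⁻¹)
  have hB₀ : 0 ≤ B₀ := div_nonneg hA (by linarith)
  have hclose : ∀ t, 0 < t → |H t - F t| ≤ B₀ := by
    intro t ht
    have := dist_le_of_le_geometric_of_tendsto₀ _ _ hr (hstep t ht) (hF' t ht)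
    simpa [ha, Real.dist_eq] using this
  have hhom : ∀ t, 0 < t → F (c * t) = N * F t := by
    intro t ht
    have h1 := hF' (c * t) (by positivity)
    have h2 := ((tendsto_add_atTop_iff_nat 1).2 (hF' t ht)).const_mul N
    refine tendsto_nhds_unique h1 (h2.congr fun m => ?_)
    simp only [ha, pow_succ]
    field_simp
  set δ := Real.log N / Real.log c
  have hδ : 0 ≤ δ := div_nonneg (Real.log_nonneg hN1.le) (Real.log_nonneg hc1.le)
  have hcδ : c ^ δ = N := by
    rw [Real.rpow_def_of_pos hc0, mul_div_cancel₀ _ (Real.log_pos hc1).ne', Real.exp_log hN0]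
  have hgrowth : ∀ m : ℕ, ∀ t, 1 ≤ t → t ≤ c ^ (m + 1) → |F t| ≤ (A + B₀) * t ^ δ := by
    intro m
    induction m with
    | zero =>
      intro t h1 ht
      have h2 := hclose t (by linarith)
      have h3 := h.le_const t h1 (by simpa using ht)
      have h4 := h.nonneg t (by linarith)
      have h5 : 1 ≤ t ^ δ := Real.one_le_rpow h1 hδ
      have h6 : |F t| ≤ A + B₀ := by
        rw [abs_le] at h2 ⊢
        constructor <;> linarith
      nlinarith [abs_nonneg (F t)]
    | succ m ih =>
      intro t h1 ht
      rcases le_or_gt t (c ^ (m + 1)) with hle | hgt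
      · exact ih t h1 hle
      · have hct : c ≤ t := by
          refine le_trans ?_ hgt.le
          exact le_self_pow₀ hc1.le (by omega)
        have h2 := ih (t / c) ((one_le_div hc0).2 hct) (by
          rw [div_le_iff₀ hc0]
          calc t ≤ c ^ (m + 1 + 1) := ht
            _ = _ := by ring)
        have h3 := hhom (t / c) (by positivity)
        rw [mul_div_cancel₀ _ hc0.ne'] at h3
        rw [h3, abs_mul, abs_of_pos hN0]
        calc N * |F (t / c)| ≤ N * ((A + B₀) * (t / c) ^ δ) := by gcongr
          _ = (A + B₀) * t ^ δ := by
            rw [Real.div_rpow (by linarith) hc0.le, hcδ]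
            field_simp
  refine ⟨F, A + B₀, by positivity, ?_, hhom, ?_, ?_⟩
  · refine measurable_of_tendsto_metrizable
      (f := fun m t => if 0 < t then a m t else 0) (fun m => ?_) (tendsto_pi_nhds.2 hF)
    refine Measurable.ite measurableSet_Ioi ?_ measurable_const
    exact (h.meas.comp (measurable_const_mul _)).const_mul _
  · exact fun t ht => (hclose t ht).trans (by linarith)
  · intro t ht
    obtain ⟨m, hm⟩ := pow_unbounded_of_one_lt t hc1
    exact hgrowth m t ht (hm.le.trans (pow_le_pow_right₀ hc1.le (by omega)))

/-- The Mellin transform of a quasi-homogeneous function, as the sum of an explicit polar part and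
a holomorphic remainder. -/
theorem mellin_eq (h : QuasiHomogeneous H c N A) :
    ∃ Ξ Ψ : ℂ → ℂ, Differentiable ℂ Ξ ∧ DifferentiableOn ℂ Ψ {s | 0 < s.re ∧ s.re < 2} ∧
      ∀ s : ℂ, 2 * Real.log N / Real.log c < s.re → s.re < 2 →
        MellinConvergent (fun t => (H t : ℂ)) (-s / 2) ∧
        mellin (fun t => (H t : ℂ)) (-s / 2)
          = Ξ s / (1 - (N : ℂ) * (c : ℂ) ^ (-s / 2)) + Ψ s := by
  have hN1 := h.one_lt
  have hN0 : 0 < N := by linarith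
  have hc1 : 1 < c := h.one_lt.trans h.lt
  have hc0 : 0 < c := by linarith
  have hA := h.bound_nonneg
  obtain ⟨F, B, hB, hFm, hFhom, hFH, hFb⟩ := h.exists_homogeneous
  have hre : ∀ s : ℂ, (-s / 2).re = -(s.re / 2) := fun s => by simp [neg_div]
  set f₁ : ℝ → ℂ := (Set.Iic 1).indicator fun t => (H t : ℂ)
  set f₂ : ℝ → ℂ := (Set.Ioi 1).indicator fun t => ((H t - F t : ℝ) : ℂ)
  set f₃ : ℝ → ℂ := (Set.Ioc 1 c).indicator fun t => (F t : ℂ)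
  set f₄ : ℝ → ℂ := (Set.Ioi 1).indicator fun t => (F t : ℂ)
  have m₁ : Measurable f₁ :=
    (Complex.measurable_ofReal.comp h.meas).indicator measurableSet_Iic
  have m₂ : Measurable f₂ :=
    (Complex.measurable_ofReal.comp (h.meas.sub hFm)).indicator measurableSet_Ioi
  have m₃ : Measurable f₃ := (Complex.measurable_ofReal.comp hFm).indicator measurableSet_Ioc
  have m₄ : Measurable f₄ := (Complex.measurable_ofReal.comp hFm).indicator measurableSet_Ioi
  have b₁ : ∀ t, 0 < t → t ≤ 1 → ‖f₁ t‖ ≤ A * t ^ (1 : ℝ) := by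
    intro t ht ht1
    simp only [f₁, Set.indicator_of_mem (Set.mem_Iic.2 ht1), Complex.norm_real,
      Real.norm_of_nonneg (h.nonneg t ht), Real.rpow_one]
    exact h.le_linear t ht ht1
  have z₁ : ∀ t, 1 < t → f₁ t = 0 := fun t ht => Set.indicator_of_notMem (by simpa using ht) _
  have z₂ : ∀ t, t ≤ 1 → f₂ t = 0 := fun t ht => Set.indicator_of_notMem (by simpa using ht) _
  have z₃ : ∀ t, t ≤ 1 → f₃ t = 0 := fun t ht =>
    Set.indicator_of_notMem (fun hm => absurd hm.1 (not_lt.2 ht)) _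
  have z₄ : ∀ t, t ≤ 1 → f₄ t = 0 := fun t ht => Set.indicator_of_notMem (by simpa using ht) _
  have r₁ : ∀ w : ℂ, -1 < w.re → MellinConvergent f₁ w ∧ DifferentiableAt ℂ (mellin f₁) w := by
    intro w hw
    refine mellin_of_rpow_bounds m₁ (C := A) (p := 1) (q := -w.re - 1) b₁ (fun t ht => ?_) hw
      (by linarith)
    rw [z₁ t ht, norm_zero]
    positivity
  have r₂ : ∀ w : ℂ, w.re < 0 → MellinConvergent f₂ w ∧ DifferentiableAt ℂ (mellin f₂) w := by
    intro w hw
    refine mellin_of_rpow_bounds m₂ (C := B) (p := -w.re + 1) (q := 0) (fun t h0 ht => ?_)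
      (fun t ht => ?_) (by linarith) (by linarith)
    · rw [z₂ t ht, norm_zero]
      positivity
    · simp only [f₂, Set.indicator_of_mem (Set.mem_Ioi.2 ht), Complex.norm_real, Real.norm_eq_abs,
        Real.rpow_zero, mul_one]
      exact hFH t (by linarith)
  set δ := Real.log N / Real.log c with hδ
  have hδ0 : 0 ≤ δ := div_nonneg (Real.log_nonneg hN1.le) (Real.log_nonneg hc1.le)
  have r₃ : ∀ w : ℂ, MellinConvergent f₃ w ∧ DifferentiableAt ℂ (mellin f₃) w := by
    intro w
    set q := -|w.re| - 1
    have hq : 0 ≤ -q := by simp only [q]; linarith [abs_nonneg w.re]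
    refine mellin_of_rpow_bounds m₃ (C := B * c ^ δ * c ^ (-q)) (p := -w.re + 1) (q := q)
      (fun t h0 ht => ?_) (fun t ht => ?_) (by linarith)
      (by simp only [q]; linarith [le_abs_self w.re])
    · rw [z₃ t ht, norm_zero]
      positivity
    · have ht0 : 0 < t := by linarith
      by_cases htc : t ≤ c
      · simp only [f₃, Set.indicator_of_mem (Set.mem_Ioc.2 ⟨ht, htc⟩), Complex.norm_real,
          Real.norm_eq_abs]
        have e1 : t ^ δ ≤ c ^ δ := by gcongr
        have e2 : 1 ≤ c ^ (-q) * t ^ q := by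
          rw [← neg_neg q, Real.rpow_neg ht0.le, neg_neg, ← div_eq_mul_inv,
            one_le_div (by positivity)]
          gcongr
        calc |F t| ≤ B * t ^ δ := hFb t ht.le
          _ ≤ B * c ^ δ * 1 := by rw [mul_one]; gcongr
          _ ≤ B * c ^ δ * (c ^ (-q) * t ^ q) := by gcongr
          _ = _ := by ring
      · have : f₃ t = 0 := Set.indicator_of_notMem (fun hm => htc hm.2) _
        rw [this, norm_zero]
        positivity
  have r₄ : ∀ w : ℂ, w.re < -δ → MellinConvergent f₄ w := by
    intro w hw
    refine (mellin_of_rpow_bounds m₄ (C := B) (p := -w.re + 1) (q := δ) (fun t h0 ht => ?_)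
      (fun t ht => ?_) (by linarith) (by linarith)).1
    · rw [z₄ t ht, norm_zero]
      positivity
    · simp only [f₄, Set.indicator_of_mem (Set.mem_Ioi.2 ht), Complex.norm_real, Real.norm_eq_abs]
      exact hFb t ht.le
  have hsum : (fun t => (H t : ℂ)) = fun t => (f₁ t + f₂ t) + f₄ t := by
    funext t
    rcases le_or_gt t 1 with ht | ht
    · rw [z₂ t ht, z₄ t ht]
      simp [f₁, ht]
    · rw [z₁ t ht]
      simp [f₂, f₄, ht]
  have hrec : ∀ t, f₄ t = f₃ t + (N : ℂ) • f₄ (c⁻¹ * t) := by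
    intro t
    rcases le_or_gt t 1 with ht | ht
    · have : c⁻¹ * t ≤ 1 := by
        rw [inv_mul_le_iff₀ hc0]; linarith
      rw [z₄ t ht, z₃ t ht, z₄ _ this]
      simp
    · rcases le_or_gt t c with htc | htc
      · have : c⁻¹ * t ≤ 1 := by
          rw [inv_mul_le_iff₀ hc0]; linarith
        rw [z₄ _ this]
        simp [f₃, f₄, ht, htc]
      · have h1 : 1 < c⁻¹ * t := by
          rw [lt_inv_mul_iff₀ hc0]; linarith
        have h2 := hFhom (c⁻¹ * t) (by linarith)
        rw [mul_inv_cancel_left₀ hc0.ne'] at h2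
        simp [f₃, f₄, ht, h1, not_le.2 htc, h2]
  have hcomp : ∀ {g : ℂ → ℂ} {s : ℂ}, DifferentiableAt ℂ g (-s / 2) →
      DifferentiableAt ℂ (fun s => g (-s / 2)) s := fun {g s} hg =>
    DifferentiableAt.comp (g := g) (f := fun s : ℂ => -s / 2) s hg (by fun_prop)
  refine ⟨fun s => mellin f₃ (-s / 2), fun s => mellin f₁ (-s / 2) + mellin f₂ (-s / 2),
    ?_, ?_, ?_⟩
  · intro s
    exact hcomp (r₃ _).2
  · intro s hs
    refine (DifferentiableAt.add ?_ ?_).differentiableWithinAt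
    · exact hcomp (r₁ _ (by rw [hre]; linarith [hs.2])).2
    · exact hcomp (r₂ _ (by rw [hre]; linarith [hs.1])).2
  · intro s hs hs2
    have hsδ : (-s / 2).re < -δ := by
      rw [hre]
      rw [mul_div_assoc] at hs
      linarith
    have hs0 : (-s / 2).re < 0 := by linarith
    have c₁ := (r₁ (-s / 2) (by rw [hre]; linarith)).1
    have c₂ := (r₂ (-s / 2) hs0).1
    have c₄ := r₄ (-s / 2) hsδ
    have s₁ := hasMellin_add c₁ c₂
    have s₂ := hasMellin_add s₁.1 c₄
    rw [hsum]
    refine ⟨s₂.1, ?_⟩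
    rw [s₂.2, s₁.2]
    have c₅ : MellinConvergent (fun t => f₄ (c⁻¹ * t)) (-s / 2) :=
      (MellinConvergent.comp_mul_left (inv_pos.2 hc0)).2 c₄
    have s₃ := hasMellin_add (r₃ (-s / 2)).1 (c₅.const_smul (N : ℂ))
    have e : (fun t => f₃ t + (N : ℂ) • f₄ (c⁻¹ * t)) = f₄ := (funext hrec).symm
    have hq : ((c⁻¹ : ℝ) : ℂ) ^ (-(-s / 2)) = (c : ℂ) ^ (-s / 2) := by
      rw [Complex.ofReal_inv, Complex.inv_cpow _ _ (by
        rw [Complex.arg_ofReal_of_nonneg hc0.le]; exact Real.pi_pos.ne), Complex.cpow_neg, inv_inv]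
    have hval := s₃.2
    rw [e, mellin_const_smul, mellin_comp_mul_left _ _ (inv_pos.2 hc0), hq, smul_eq_mul,
      smul_eq_mul] at hval
    have hne := one_sub_mul_cpow_ne_zero hc1 hN0 hs
    have : mellin f₄ (-s / 2) = mellin f₃ (-s / 2) / (1 - (N : ℂ) * (c : ℂ) ^ (-s / 2)) := by
      rw [eq_div_iff hne]
      linear_combination hval
    rw [this]
    ring

open MeasureTheory in
theorem mellin_tendsto_uniformly (h : QuasiHomogeneous H c N A) {G : ℕ → ℝ → ℝ}
    (hG : ∀ n, Measurable (G n)) (hG0 : ∀ n t, 0 < t → 0 ≤ G n t)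
    (hGH : ∀ n t, 0 < t → G n t ≤ H t)
    (hlim : ∀ t, 0 < t → Tendsto (fun n => G n t) atTop (nhds (H t))) {x : ℝ}
    (hx : 2 * Real.log N / Real.log c < x) (hx2 : x < 2) :
    ∃ ε : ℕ → ℝ, Tendsto ε atTop (nhds 0) ∧ ∀ n, ∀ s : ℂ, s.re = x →
      ‖mellin (fun t => (G n t : ℂ)) (-s / 2) - mellin (fun t => (H t : ℂ)) (-s / 2)‖ ≤ ε n := by
  obtain ⟨_, _, _, _, hconv⟩ := h.mellin_eq
  have hHc := fun (s : ℂ) (hs : s.re = x) => (hconv s (by rwa [hs]) (by rwa [hs])).1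
  have hre : ∀ s : ℂ, (-s / 2).re = -(s.re / 2) := fun s => by simp [neg_div]
  have hnorm : ∀ s : ℂ, s.re = x → ∀ t : ℝ, 0 < t → ‖(t : ℂ) ^ (-s / 2 - 1)‖ = t ^ (-(x / 2) - 1) := by
    intro s hs t ht
    rw [Complex.norm_cpow_eq_rpow_re_of_pos ht, Complex.sub_re, hre, hs, Complex.one_re]
  have hcpow : ∀ s : ℂ, Measurable fun t : ℝ => (t : ℂ) ^ (-s / 2 - 1) := fun s => by fun_prop
  have hHint : IntegrableOn (fun t => t ^ (-(x / 2) - 1) * H t) (Set.Ioi 0) := by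
    refine IntegrableOn.congr_fun (hHc (x : ℂ) (by simp)).norm (fun t ht => ?_) measurableSet_Ioi
    simp only [norm_smul]
    rw [hnorm _ (by simp) t ht, Complex.norm_real, Real.norm_of_nonneg (h.nonneg t ht)]
  have hGc : ∀ n, ∀ s : ℂ, s.re = x → MellinConvergent (fun t => (G n t : ℂ)) (-s / 2) := by
    intro n s hs
    refine Integrable.mono' hHint
      ((hcpow s).smul (Complex.measurable_ofReal.comp (hG n))).aestronglyMeasurable ?_
    refine (ae_restrict_iff' measurableSet_Ioi).2 (Eventually.of_forall fun t ht => ?_)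
    have ht0 : (0 : ℝ) < t := ht
    rw [norm_smul, hnorm s hs t ht, Complex.norm_real, Real.norm_of_nonneg (hG0 n t ht)]
    have := hGH n t ht
    gcongr
  refine ⟨fun n => ∫ t in Set.Ioi 0, t ^ (-(x / 2) - 1) * (H t - G n t), ?_, ?_⟩
  · suffices Tendsto (fun n => ∫ t in Set.Ioi (0 : ℝ), t ^ (-(x / 2) - 1) * (H t - G n t)) atTop
        (nhds (∫ _ in Set.Ioi (0 : ℝ), (0 : ℝ))) by simpa using this
    refine tendsto_integral_of_dominated_convergence (fun t => t ^ (-(x / 2) - 1) * H t)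
      (fun n => ?_) hHint (fun n => ?_) ?_
    · exact ((measurable_id.pow_const _).mul (h.meas.sub (hG n))).aestronglyMeasurable
    · refine (ae_restrict_iff' measurableSet_Ioi).2 (Eventually.of_forall fun t ht => ?_)
      have ht0 : (0 : ℝ) < t := ht
      have h1 := hGH n t ht
      have h2 := hG0 n t ht
      rw [Real.norm_of_nonneg (mul_nonneg (by positivity) (by linarith))]
      gcongr
      linarith
    · refine (ae_restrict_iff' measurableSet_Ioi).2 (Eventually.of_forall fun t ht => ?_)
      have := ((hlim t ht).const_sub (H t)).const_mul (t ^ (-(x / 2) - 1))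
      simpa using this
  · intro n s hs
    rw [norm_sub_rev, ← (hasMellin_sub (hHc s hs) (hGc n s hs)).2, mellin]
    refine (norm_integral_le_integral_norm _).trans_eq ?_
    refine setIntegral_congr_fun measurableSet_Ioi fun t ht => ?_
    have h1 := hGH n t ht
    simp only [norm_smul]
    rw [hnorm s hs t ht, ← Complex.ofReal_sub, Complex.norm_real,
      Real.norm_of_nonneg (by linarith)]

end QuasiHomogeneous

/-- The Dirichlet sum `∑ x^{-s/2}` over a finite multiset of reals. -/
noncomputable def powSum (Λ : Multiset ℝ) (s : ℂ) : ℂ :=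
  (Λ.map fun x : ℝ => (x : ℂ) ^ (-s / 2)).sum

theorem differentiable_powSum {Λ : Multiset ℝ} (hΛ : ∀ x ∈ Λ, 0 < x) :
    Differentiable ℂ (powSum Λ) := by
  induction Λ using Multiset.induction_on with
  | empty =>
    have : powSum 0 = fun _ => 0 := by funext s; simp [powSum]
    rw [this]
    fun_prop
  | cons x Λ ih =>
    have : powSum (x ::ₘ Λ) = fun s => (x : ℂ) ^ (-s / 2) + powSum Λ s := by
      funext s; simp [powSum]
    rw [this]
    have hx : (x : ℂ) ≠ 0 := by
      exact_mod_cast (hΛ x (Multiset.mem_cons_self x Λ)).ne'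
    refine Differentiable.add (fun s => ?_) (ih fun y hy => hΛ y (Multiset.mem_cons_of_mem hy))
    exact DifferentiableAt.const_cpow (by fun_prop) (Or.inl hx)

theorem norm_powSum_le {Λ : Multiset ℝ} (hΛ : ∀ x ∈ Λ, 0 < x) (s : ℂ) :
    ‖powSum Λ s‖ ≤ (Λ.map fun x : ℝ => x ^ (-s.re / 2)).sum := by
  induction Λ using Multiset.induction_on with
  | empty => simp [powSum]
  | cons x Λ ih =>
    have hx := hΛ x (Multiset.mem_cons_self x Λ)
    have e : ‖(x : ℂ) ^ (-s / 2)‖ = x ^ (-s.re / 2) := by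
      rw [Complex.norm_cpow_eq_rpow_re_of_pos hx]; simp
    have := ih fun y hy => hΛ y (Multiset.mem_cons_of_mem hy)
    simp only [powSum, Multiset.map_cons, Multiset.sum_cons] at *
    exact (norm_add_le _ _).trans (by rw [e]; gcongr)

theorem powSum_ofReal {Λ : Multiset ℝ} (hΛ : ∀ x ∈ Λ, 0 < x) (x : ℝ) :
    powSum Λ x = ((Λ.map fun y : ℝ => y ^ (-x / 2)).sum : ℝ) := by
  induction Λ using Multiset.induction_on with
  | empty => simp [powSum]
  | cons y Λ ih =>
    have hy := hΛ y (Multiset.mem_cons_self y Λ)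
    have := ih fun y hy => hΛ y (Multiset.mem_cons_of_mem hy)
    simp only [powSum, Multiset.map_cons, Multiset.sum_cons] at *
    rw [this, Complex.ofReal_add, Complex.ofReal_cpow hy.le]
    simp

theorem sum_rpow_le_sum_rpow {Λ : Multiset ℝ} (hΛ : ∀ x ∈ Λ, 0 < x) {x₀ x : ℝ} (hx₀ : 0 < x₀)
    (hx : x₀ ≤ x) :
    0 ≤ (Λ.map fun y : ℝ => y ^ (-x₀ / 2)).sum ∧ (Λ.map fun y : ℝ => y ^ (-x / 2)).sum
      ≤ (Λ.map fun y : ℝ => y ^ (-x₀ / 2)).sum ^ (x / x₀) := by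
  have hp : 1 ≤ x / x₀ := (one_le_div hx₀).2 hx
  induction Λ using Multiset.induction_on with
  | empty => simp [Real.zero_rpow (show x / x₀ ≠ 0 by linarith)]
  | cons y Λ ih =>
    have hy := hΛ y (Multiset.mem_cons_self y Λ)
    obtain ⟨h0, h1⟩ := ih fun y hy => hΛ y (Multiset.mem_cons_of_mem hy)
    simp only [Multiset.map_cons, Multiset.sum_cons]
    refine ⟨by positivity, ?_⟩
    have e : y ^ (-x / 2) = (y ^ (-x₀ / 2)) ^ (x / x₀) := by
      rw [← Real.rpow_mul hy.le]
      congr 1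
      field_simp
    refine le_trans ?_ (Real.add_rpow_le_rpow_add (by positivity) h0 hp)
    rw [e]
    gcongr

/-- A sequence of holomorphic functions, bounded in vertical strips and converging fast enough on
the left boundary line, converges in the interior of the half-plane to a holomorphic function. -/
theorem exists_tendsto_of_three_lines {Z : ℕ → ℂ → ℂ} {L : ℂ → ℂ} {x₀ : ℝ} (hx₀ : 0 < x₀)
    (hZ : ∀ n, Differentiable ℂ (Z n))
    (hbdd : ∀ X, ∃ B, ∀ n s, x₀ ≤ s.re → s.re ≤ X → ‖Z n s‖ ≤ B)
    {ε : ℕ → ℝ} (hε : Tendsto ε atTop (nhds 0))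
    (hline : ∀ n s, s.re = x₀ → ‖Complex.exp (s ^ 2) * (Z n s - L s)‖ ≤ ε n) :
    ∃ ζ : ℂ → ℂ, DifferentiableOn ℂ ζ {s | x₀ < s.re} ∧
      ∀ s : ℂ, x₀ < s.re → Tendsto (fun n => Z n s) atTop (nhds (ζ s)) := by
  have hε0 : ∀ n, 0 ≤ ε n := fun n => (norm_nonneg _).trans (hline n (x₀ : ℂ) (by simp))
  have key : ∀ s₀ : ℂ, x₀ < s₀.re → ∃ r > 0, UniformCauchySeqOn Z atTop (Metric.ball s₀ r) := by
    intro s₀ hs₀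
    set r := s₀.re - x₀ with hr
    have hr0 : 0 < r := by linarith
    refine ⟨r, hr0, ?_⟩
    set X := s₀.re + r + 1 with hX
    obtain ⟨B, hB⟩ := hbdd X
    have hB0 : 0 ≤ B := (norm_nonneg _).trans (hB 0 (x₀ : ℂ) (by simp) (by simp; linarith))
    set B' := max 1 (Real.exp (X ^ 2) * (B + B))
    have hexp : ∀ s : ℂ, x₀ ≤ s.re → s.re ≤ X → ‖Complex.exp (s ^ 2)‖ ≤ Real.exp (X ^ 2) := by
      intro s h1 h2
      rw [Complex.norm_exp]
      gcongr
      have : (s ^ 2).re = s.re ^ 2 - s.im ^ 2 := by rw [sq]; simp; ring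
      rw [this]
      nlinarith [sq_nonneg s.im]
    set E := Real.exp ((‖s₀‖ + r) ^ 2)
    set η := 1 / (X - x₀) with hη
    have hη0 : 0 < η := by rw [hη]; apply one_div_pos.2; linarith
    have hest : ∀ n m, ε n + ε m ≤ 1 → ∀ s ∈ Metric.ball s₀ r,
        ‖Z n s - Z m s‖ ≤ E * (B' * (ε n + ε m) ^ η) := by
      intro n m hnm s hs
      have hsr : |s.re - s₀.re| < r := by
        refine lt_of_le_of_lt ?_ (mem_ball_iff_norm.1 hs)
        rw [← Complex.sub_re]
        exact Complex.abs_re_le_norm _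
      obtain ⟨hs1, hs2⟩ := abs_lt.1 hsr
      have h3 := Complex.HadamardThreeLines.norm_le_interp_of_mem_verticalClosedStrip'
        (f := fun w => Complex.exp (w ^ 2) * (Z n w - Z m w)) (l := x₀) (u := X) (z := s)
        (a := ε n + ε m) (b := B') (by linarith) ⟨by linarith, by linarith⟩ ?_ ?_ ?_ ?_
      · set θ := (s.re - x₀) / (X - x₀) with hθ
        have hθ0 : 0 ≤ θ := div_nonneg (by linarith) (by linarith)
        have hθ1 : η ≤ 1 - θ := by
          rw [hθ, hη, one_sub_div (by linarith)]
          gcongr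
          linarith
          linarith
        have hB1 : B' ^ θ ≤ B' := by
          calc B' ^ θ ≤ B' ^ (1 : ℝ) :=
                Real.rpow_le_rpow_of_exponent_le (le_max_left _ _) (by linarith)
            _ = B' := Real.rpow_one _
        have h4 : (ε n + ε m) ^ (1 - θ) ≤ (ε n + ε m) ^ η :=
          Real.rpow_le_rpow_of_exponent_ge' (add_nonneg (hε0 n) (hε0 m)) hnm hη0.le hθ1
        have h5 : Z n s - Z m s
            = Complex.exp (-s ^ 2) * (Complex.exp (s ^ 2) * (Z n s - Z m s)) := by
          rw [← mul_assoc, ← Complex.exp_add]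
          simp
        have h6 : ‖Complex.exp (-s ^ 2)‖ ≤ E := by
          refine (Complex.norm_exp_le_exp_norm _).trans (Real.exp_le_exp.2 ?_)
          rw [norm_neg, norm_pow]
          gcongr
          have := norm_le_norm_add_norm_sub' s s₀
          have := mem_ball_iff_norm.1 hs
          linarith
        have hB'0 : 0 ≤ B' := zero_le_one.trans (le_max_left _ _)
        rw [h5, norm_mul]
        refine mul_le_mul h6 (h3.trans ?_) (norm_nonneg _) (Real.exp_pos _).le
        rw [mul_comm]
        have := Real.rpow_nonneg (add_nonneg (hε0 n) (hε0 m)) (1 - θ)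
        gcongr
      · have hd : Differentiable ℂ fun w => Complex.exp (w ^ 2) * (Z n w - Z m w) := by
          have := hZ n
          have := hZ m
          fun_prop
        exact hd.diffContOnCl
      · refine ⟨Real.exp (X ^ 2) * (B + B), ?_⟩
        rintro _ ⟨w, hw, rfl⟩
        simp only [Function.comp, norm_mul]
        refine mul_le_mul (hexp w hw.1 hw.2) ((norm_sub_le _ _).trans
          (add_le_add (hB n w hw.1 hw.2) (hB m w hw.1 hw.2))) (norm_nonneg _) (Real.exp_pos _).le
      · intro w hw
        have e : Complex.exp (w ^ 2) * (Z n w - Z m w) = Complex.exp (w ^ 2) * (Z n w - L w)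
            - Complex.exp (w ^ 2) * (Z m w - L w) := by ring
        rw [e]
        exact (norm_sub_le _ _).trans (add_le_add (hline n w hw) (hline m w hw))
      · intro w hw
        have hw' : w.re = X := hw
        refine le_trans ?_ (le_max_right _ _)
        have h1 : x₀ ≤ w.re := by linarith
        rw [norm_mul]
        refine mul_le_mul (hexp w h1 hw'.le) ((norm_sub_le _ _).trans
          (add_le_add (hB n w h1 hw'.le) (hB m w h1 hw'.le))) (norm_nonneg _) (Real.exp_pos _).le
    rw [Metric.uniformCauchySeqOn_iff]
    intro δ hδ
    have h2 : Tendsto (fun p : ℕ × ℕ => ε p.1 + ε p.2) (atTop ×ˢ atTop) (nhds 0) := by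
      have := (hε.comp tendsto_fst).add (hε.comp (tendsto_snd (f := atTop (α := ℕ))))
      simpa using this
    have h3 : Tendsto (fun p : ℕ × ℕ => E * (B' * (ε p.1 + ε p.2) ^ η)) (atTop ×ˢ atTop)
        (nhds 0) := by
      have := ((h2.rpow_const (p := η) (Or.inr hη0.le)).const_mul B').const_mul E
      simpa [Real.zero_rpow hη0.ne'] using this
    have h4 := (h3.eventually_lt_const hδ).and (h2.eventually_le_const zero_lt_one)
    rw [prod_atTop_atTop_eq, eventually_atTop] at h4
    obtain ⟨⟨p, q⟩, hpq⟩ := h4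
    refine ⟨max p q, fun m hm n hn s hs => ?_⟩
    have := hpq (m, n) ⟨(le_max_left _ _).trans hm, (le_max_right _ _).trans hn⟩
    rw [dist_eq_norm]
    exact (hest m n this.2 s hs).trans_lt this.1
  have hlim : ∀ s : ℂ, x₀ < s.re → ∃ l, Tendsto (fun n => Z n s) atTop (nhds l) := by
    intro s hs
    obtain ⟨r, hr, h⟩ := key s hs
    exact cauchySeq_tendsto_of_complete (h.cauchySeq (Metric.mem_ball_self hr))
  choose! ζ hζ using hlim
  refine ⟨ζ, ?_, hζ⟩
  have hloc : TendstoLocallyUniformlyOn Z ζ atTop {s | x₀ < s.re} := by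
    intro u hu s hs
    obtain ⟨r, hr, h⟩ := key s hs
    have hopen : IsOpen {s : ℂ | x₀ < s.re} := isOpen_lt continuous_const Complex.continuous_re
    have h2 := (h.mono (s' := Metric.ball s r ∩ {s | x₀ < s.re})
      Set.inter_subset_left).tendstoUniformlyOn_of_tendsto (fun w hw => hζ w hw.2)
    exact ⟨_, inter_mem (mem_nhdsWithin_of_mem_nhds (Metric.ball_mem_nhds s hr))
      self_mem_nhdsWithin, h2 u hu⟩
  exact hloc.differentiableOn (Eventually.of_forall fun n => (hZ n).differentiableOn)
    (isOpen_lt continuous_const Complex.continuous_re)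

/-- The Gaussian factor `exp (s²)` beats `s * sin (π s)` on vertical lines. -/
theorem exists_norm_exp_sq_mul_le (x : ℝ) : ∃ C, 0 ≤ C ∧ ∀ s : ℂ, s.re = x →
    ‖Complex.exp (s ^ 2) * (s / 2 * Complex.sin (Real.pi * (s / 2)) / Real.pi)‖ ≤ C := by
  have hsin : ∀ z : ℂ, ‖Complex.sin z‖ ≤ Real.exp ‖z‖ := by
    intro z
    rw [Complex.sin, norm_div, norm_mul, Complex.norm_I, mul_one, Complex.norm_two]
    have h1 := Complex.norm_exp_le_exp_norm (-z * Complex.I)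
    have h2 := Complex.norm_exp_le_exp_norm (z * Complex.I)
    rw [norm_mul, Complex.norm_I, mul_one] at h1 h2
    rw [norm_neg] at h1
    have := norm_sub_le (Complex.exp (-z * Complex.I)) (Complex.exp (z * Complex.I))
    linarith
  refine ⟨Real.exp (x ^ 2 + (1 + Real.pi / 2) * |x| + (1 + Real.pi / 2) ^ 2), by positivity, ?_⟩
  intro s hs
  set k := 1 + Real.pi / 2 with hk
  have hk0 : 0 ≤ k := by positivity
  have h1 : ‖s / 2 * Complex.sin (Real.pi * (s / 2)) / Real.pi‖ ≤ Real.exp (k * ‖s‖) := by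
    rw [norm_div, norm_mul, norm_div, Complex.norm_two, Complex.norm_real,
      Real.norm_of_nonneg Real.pi_pos.le, div_le_iff₀ Real.pi_pos]
    have e1 := hsin (Real.pi * (s / 2))
    rw [norm_mul, norm_div, Complex.norm_two, Complex.norm_real,
      Real.norm_of_nonneg Real.pi_pos.le] at e1
    have e2 := Real.add_one_le_exp ‖s‖
    have e3 : Real.exp (k * ‖s‖) = Real.exp ‖s‖ * Real.exp (Real.pi * (‖s‖ / 2)) := by
      rw [← Real.exp_add, hk]; ring_nf
    rw [e3]
    have e4 : ‖s‖ / 2 * ‖Complex.sin (Real.pi * (s / 2))‖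
        ≤ Real.exp ‖s‖ * Real.exp (Real.pi * (‖s‖ / 2)) := by
      gcongr
      linarith [norm_nonneg s]
    refine e4.trans (le_mul_of_one_le_right (by positivity) ?_)
    linarith [Real.pi_gt_three]
  rw [norm_mul, Complex.norm_exp]
  have h2 : (s ^ 2).re = x ^ 2 - s.im ^ 2 := by rw [sq, ← hs]; simp; ring
  refine (mul_le_mul_of_nonneg_left h1 (Real.exp_pos _).le).trans ?_
  rw [← Real.exp_add, Real.exp_le_exp, h2]
  have h3 : ‖s‖ ≤ |x| + |s.im| := by rw [← hs]; exact Complex.norm_le_abs_re_add_abs_im s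
  have h4 := mul_le_mul_of_nonneg_left h3 hk0
  nlinarith [sq_nonneg (|s.im| - k), sq_abs s.im, abs_nonneg s.im]

theorem hasMellin_sum_log {Λ : Multiset ℝ} (hΛ : ∀ x ∈ Λ, 0 < x) {s : ℂ} (h0 : 0 < s.re)
    (h2 : s.re < 2) :
    HasMellin (fun t : ℝ => (((Λ.map fun x => Real.log (1 + t / x)).sum : ℝ) : ℂ)) (-s / 2)
      (powSum Λ s * (Real.pi / (s / 2 * Complex.sin (Real.pi * (s / 2))))) := by
  have hre : (s / 2).re = s.re / 2 := by simp
  have hlog := hasMellin_log_one_add (σ := s / 2) (by rw [hre]; linarith) (by rw [hre]; linarith)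
  rw [← neg_div] at hlog
  induction Λ using Multiset.induction_on with
  | empty => simp [powSum, HasMellin, MellinConvergent, mellin]
  | cons x Λ ih =>
    have hx := hΛ x (Multiset.mem_cons_self x Λ)
    have hi := inv_pos.2 hx
    have ih := ih fun y hy => hΛ y (Multiset.mem_cons_of_mem hy)
    have hc : MellinConvergent (fun t : ℝ => (Real.log (1 + x⁻¹ * t) : ℂ)) (-s / 2) :=
      (MellinConvergent.comp_mul_left (f := fun t : ℝ => (Real.log (1 + t) : ℂ)) hi).2 hlog.1
    have hv := mellin_comp_mul_left (fun t : ℝ => (Real.log (1 + t) : ℂ)) (-s / 2) hi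
    have hq : ((x⁻¹ : ℝ) : ℂ) ^ (-(-s / 2)) = (x : ℂ) ^ (-s / 2) := by
      rw [Complex.ofReal_inv, Complex.inv_cpow _ _ (by
        rw [Complex.arg_ofReal_of_nonneg hx.le]; exact Real.pi_pos.ne), Complex.cpow_neg, inv_inv]
    have hs := hasMellin_add hc ih.1
    rw [hv, hlog.2, hq, ih.2] at hs
    convert hs using 1
    · funext t
      simp [div_eq_inv_mul]
    · simp [powSum, add_mul]

theorem sin_pi_mul_half_ne_zero {s : ℂ} (h0 : 0 < s.re) (h2 : s.re < 2) :
    Complex.sin (Real.pi * (s / 2)) ≠ 0 := by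
  intro h
  obtain ⟨k, hk⟩ := Complex.sin_eq_zero_iff.1 h
  have hpi : (Real.pi : ℂ) ≠ 0 := by exact_mod_cast Real.pi_ne_zero
  have h3 : s / 2 = k := by
    apply mul_left_cancel₀ hpi
    rw [hk, mul_comm]
  have h4 : s.re / 2 = k := by
    have := congrArg Complex.re h3
    simpa using this
  have h5 : (0 : ℝ) < k := by linarith
  have h6 : (k : ℝ) < 1 := by linarith
  norm_cast at h5 h6
  omega

namespace QuasiHomogeneous

variable {H : ℝ → ℝ} {c N A : ℝ}

/-- If the logarithms of the products `∏ (1 + t / x)` increase to a quasi-homogeneous function,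
the associated Dirichlet sums converge to a function with a meromorphic continuation. -/
theorem exists_tendsto_powSum (h : QuasiHomogeneous H c N A) {Λ : ℕ → Multiset ℝ}
    (hΛ : ∀ n, ∀ x ∈ Λ n, 0 < x)
    (hle : ∀ n t, 0 < t → ((Λ n).map fun x => Real.log (1 + t / x)).sum ≤ H t)
    (hlim : ∀ t, 0 < t →
      Tendsto (fun n => ((Λ n).map fun x => Real.log (1 + t / x)).sum) atTop (nhds (H t))) :
    ∃ ζ ξ ψ : ℂ → ℂ,
      (∀ s : ℂ, 2 * Real.log N / Real.log c < s.re →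
        Tendsto (fun n => powSum (Λ n) s) atTop (nhds (ζ s))) ∧
      Differentiable ℂ ξ ∧ DifferentiableOn ℂ ψ {s : ℂ | 0 < s.re} ∧
      ∀ s : ℂ, 2 * Real.log N / Real.log c < s.re →
        ζ s = ξ s / (1 - (N : ℂ) * (c : ℂ) ^ (-s / 2)) + ψ s := by
  have hN1 := h.one_lt
  have hN0 : 0 < N := by linarith
  have hc1 : 1 < c := h.one_lt.trans h.lt
  have hc0 : (c : ℂ) ≠ 0 := by exact_mod_cast (zero_lt_one.trans hc1).ne'
  have hlogc := Real.log_pos hc1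
  obtain ⟨Ξ, Ψ, hΞ, hΨ, hmellin⟩ := h.mellin_eq
  set G : ℕ → ℝ → ℝ := fun n t => ((Λ n).map fun x => Real.log (1 + t / x)).sum with hG
  have hGm : ∀ n, Measurable (G n) := by
    intro n
    have : ∀ M : Multiset ℝ, Measurable fun t : ℝ => (M.map fun x => Real.log (1 + t / x)).sum := by
      intro M
      induction M using Multiset.induction_on with
      | empty => simp
      | cons x M ih =>
        simp only [Multiset.map_cons, Multiset.sum_cons]
        fun_prop
    exact this _
  have hG0 : ∀ n t, 0 < t → 0 ≤ G n t := by
    intro n t ht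
    refine Multiset.sum_nonneg fun u hu => ?_
    obtain ⟨x, hx, rfl⟩ := Multiset.mem_map.1 hu
    have := div_pos ht (hΛ n x hx)
    exact Real.log_nonneg (by linarith)
  set d := 2 * Real.log N / Real.log c with hd
  have hd0 : 0 < d := div_pos (mul_pos two_pos (Real.log_pos hN1)) hlogc
  have hd2 : d < 2 := by
    rw [hd, div_lt_iff₀ hlogc]
    have := Real.log_lt_log hN0 h.lt
    linarith
  set K : ℂ → ℂ := fun s => s / 2 * Complex.sin (Real.pi * (s / 2)) / Real.pi with hK
  have hKd : Differentiable ℂ K := by fun_prop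
  set L : ℂ → ℂ := fun s => K s * mellin (fun t => (H t : ℂ)) (-s / 2) with hL
  have hZ : ∀ n s, 0 < s.re → s.re < 2 →
      powSum (Λ n) s = K s * mellin (fun t => (G n t : ℂ)) (-s / 2) := by
    intro n s h0 h2
    rw [(hasMellin_sum_log (hΛ n) h0 h2).2]
    have h3 := sin_pi_mul_half_ne_zero h0 h2
    have h4 : s ≠ 0 := by rintro rfl; simp at h0
    have h5 : (Real.pi : ℂ) ≠ 0 := by exact_mod_cast Real.pi_ne_zero
    simp only [hK]
    generalize Complex.sin (Real.pi * (s / 2)) = w at h3 ⊢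
    field_simp
  have hline : ∀ x, d < x → x < 2 → ∃ ε : ℕ → ℝ, Tendsto ε atTop (nhds 0) ∧ ∀ n, ∀ s : ℂ,
      s.re = x → ‖Complex.exp (s ^ 2) * (powSum (Λ n) s - L s)‖ ≤ ε n := by
    intro x hx hx2
    obtain ⟨ε, hε, hest⟩ := h.mellin_tendsto_uniformly hGm hG0 hle hlim hx hx2
    obtain ⟨C, hC0, hC⟩ := exists_norm_exp_sq_mul_le x
    refine ⟨fun n => C * ε n, by simpa using hε.const_mul C, fun n s hs => ?_⟩
    rw [hZ n s (by linarith) (by linarith), hL, ← mul_sub, ← mul_assoc, norm_mul]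
    exact mul_le_mul (hC s hs) (hest n s hs) (norm_nonneg _) hC0
  have hstrip : ∀ s : ℂ, d < s.re → s.re < 2 →
      Tendsto (fun n => powSum (Λ n) s) atTop (nhds (L s)) := by
    intro s h1 h2
    obtain ⟨ε, hε, hest⟩ := hline s.re h1 h2
    have h3 : Tendsto (fun n => Complex.exp (s ^ 2) * (powSum (Λ n) s - L s)) atTop (nhds 0) :=
      squeeze_zero_norm (fun n => hest n s rfl) hε
    have h4 := (h3.const_mul (Complex.exp (-s ^ 2))).add_const (L s)
    simpa [← mul_assoc, ← Complex.exp_add] using h4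
  have hhalf : ∀ x₀, d < x₀ → x₀ < 2 → ∃ ζ : ℂ → ℂ, DifferentiableOn ℂ ζ {s | x₀ < s.re} ∧
      ∀ s : ℂ, x₀ < s.re → Tendsto (fun n => powSum (Λ n) s) atTop (nhds (ζ s)) := by
    intro x₀ hx₀ hx₂
    have hx0 : 0 < x₀ := hd0.trans hx₀
    obtain ⟨ε, hε, hest⟩ := hline x₀ hx₀ hx₂
    refine exists_tendsto_of_three_lines hx0 (fun n => differentiable_powSum (hΛ n)) ?_ hε hest
    intro X
    obtain ⟨M, hM⟩ := (Metric.isBounded_range_of_tendsto _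
      (hstrip (x₀ : ℂ) (by simpa using hx₀) (by simpa using hx₂))).exists_norm_le
    refine ⟨max 1 M ^ (X / x₀), fun n s h1 h2 => ?_⟩
    obtain ⟨e0, e1⟩ := sum_rpow_le_sum_rpow (hΛ n) hx0 h1
    have e2 : ‖powSum (Λ n) (x₀ : ℂ)‖ ≤ M := hM _ ⟨n, rfl⟩
    rw [powSum_ofReal (hΛ n), Complex.norm_real, Real.norm_of_nonneg e0] at e2
    calc ‖powSum (Λ n) s‖ ≤ _ := norm_powSum_le (hΛ n) s
      _ ≤ _ := e1
      _ ≤ (max 1 M) ^ (s.re / x₀) := by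
        apply Real.rpow_le_rpow e0 (e2.trans (le_max_right _ _))
        exact div_nonneg (by linarith) hx0.le
      _ ≤ _ := by
        apply Real.rpow_le_rpow_of_exponent_le (le_max_left _ _)
        gcongr
  have hopen : ∀ x : ℝ, IsOpen {s : ℂ | x < s.re} := fun x =>
    isOpen_lt continuous_const Complex.continuous_re
  have hnear : ∀ s : ℂ, d < s.re → ∃ x₀, d < x₀ ∧ x₀ < 2 ∧ x₀ < s.re := fun s hs => by
    obtain ⟨x₀, h1, h2⟩ := exists_between (lt_min hs hd2)
    exact ⟨x₀, h1, h2.trans_le (min_le_right _ _), h2.trans_le (min_le_left _ _)⟩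
  have hex : ∀ s : ℂ, d < s.re → ∃ l, Tendsto (fun n => powSum (Λ n) s) atTop (nhds l) := by
    intro s hs
    obtain ⟨x₀, h1, h2, h3⟩ := hnear s hs
    obtain ⟨ζ, -, hζ⟩ := hhalf x₀ h1 h2
    exact ⟨_, hζ s h3⟩
  choose! ζ hζ using hex
  have hζd : ∀ s : ℂ, d < s.re → DifferentiableAt ℂ ζ s := by
    intro s hs
    obtain ⟨x₀, h1, h2, h3⟩ := hnear s hs
    obtain ⟨ζ', hd', hζ'⟩ := hhalf x₀ h1 h2
    refine (hd'.differentiableAt ((hopen x₀).mem_nhds h3)).congr_of_eventuallyEq ?_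
    filter_upwards [(hopen x₀).mem_nhds h3] with w hw
    exact tendsto_nhds_unique (hζ w (h1.trans hw)) (hζ' w hw)
  have hval : ∀ s : ℂ, d < s.re → s.re < 2 →
      ζ s = K s * Ξ s / (1 - (N : ℂ) * (c : ℂ) ^ (-s / 2)) + K s * Ψ s := by
    intro s h1 h2
    rw [tendsto_nhds_unique (hζ s h1) (hstrip s h1 h2), hL]
    simp only
    rw [(hmellin s h1 h2).2]
    ring
  have hpol : ∀ s : ℂ, d < s.re →
      DifferentiableAt ℂ (fun s => ζ s - K s * Ξ s / (1 - (N : ℂ) * (c : ℂ) ^ (-s / 2))) s := by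
    intro s hs
    have e1 : DifferentiableAt ℂ (fun s : ℂ => (c : ℂ) ^ (-s / 2)) s :=
      DifferentiableAt.const_cpow (by fun_prop) (Or.inl hc0)
    have e2 := one_sub_mul_cpow_ne_zero hc1 hN0 hs
    exact (hζd s hs).sub (((hKd s).mul (hΞ s)).div ((e1.const_mul _).const_sub _) e2)
  refine ⟨ζ, fun s => K s * Ξ s, fun s => if s.re < 2 then K s * Ψ s else
    ζ s - K s * Ξ s / (1 - (N : ℂ) * (c : ℂ) ^ (-s / 2)), hζ, hKd.mul hΞ, ?_, ?_⟩
  · intro s hs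
    have hs0 : 0 < s.re := hs
    refine DifferentiableAt.differentiableWithinAt ?_
    rcases lt_or_ge s.re 2 with h2 | h2
    · have hmem : {s : ℂ | 0 < s.re ∧ s.re < 2} ∈ nhds s :=
        ((hopen 0).inter (isOpen_lt Complex.continuous_re continuous_const)).mem_nhds ⟨hs0, h2⟩
      refine ((hKd s).mul (hΨ.differentiableAt hmem)).congr_of_eventuallyEq ?_
      filter_upwards [hmem] with w hw
      simp [hw.2]
    · have hsd : d < s.re := hd2.trans_le h2
      refine (hpol s hsd).congr_of_eventuallyEq ?_
      filter_upwards [(hopen d).mem_nhds hsd] with w hw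
      split_ifs with hw2
      · rw [hval w hw hw2]
        ring
      · rfl
  · intro s hs
    beta_reduce
    split_ifs with h2
    · exact hval s hs h2
    · simp

end QuasiHomogeneous

theorem exists_scaled_roots {R : ℝ[X]} (hR0 : R.eval 0 = 0) {a c z₀ : ℝ} (hc : 0 < c)
    (hinv : ∀ z : ℂ, memIcc a (aeval z R) → memIcc a z) (hz₀ : 0 < z₀) (hza : z₀ ≤ a) (n : ℕ) :
    ∃ Λ : Multiset ℝ, (∀ x ∈ Λ, 0 < x) ∧ zetaPartial R c z₀ n = powSum Λ ∧
      ∀ t, 1 + scaledIter (fun y => -R.eval (-y)) c n t / z₀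
        = (Λ.map fun x => 1 + t / x).prod := by
  obtain ⟨Λ, hΛ, hroots, hprod, -, -⟩ := exists_real_level_roots (polyIter R n)
    (polyIter_eval_zero hR0 n) hz₀ fun z hz =>
      memIcc_of_aeval_polyIter hinv n z (by rw [hz]; exact memIcc_ofReal ⟨hz₀.le, hza⟩)
  refine ⟨Λ.map fun x => c ^ n * x, ?_, ?_, fun t => ?_⟩
  · intro x hx
    obtain ⟨y, hy, rfl⟩ := Multiset.mem_map.1 hx
    exact mul_pos (by positivity) (hΛ y hy).1
  · funext s
    rw [zetaPartial, preimageRoots, hroots, powSum, Multiset.map_map, Multiset.map_map]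
    congr 1
    refine Multiset.map_congr rfl fun x hx => ?_
    have : (x : ℂ) ≠ 0 := by exact_mod_cast (hΛ x hx).1.ne'
    simp [this]
  · have h1 := hprod (-(t / c ^ n))
    rw [polyIter_eval_neg, neg_div, sub_neg_eq_add] at h1
    rw [h1, Multiset.map_map]
    congr 1
    refine Multiset.map_congr rfl fun x hx => ?_
    simp [neg_div, div_div]

/-- The claim for a positive base point. -/
theorem exists_zeta_of_pos {R : ℝ[X]} (hR2 : 2 ≤ R.natDegree) (hR0 : R.eval 0 = 0)
    {a c z₀ : ℝ} (hc : R.derivative.eval 0 = c) (ha : 0 < a)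
    (hinv : ∀ z : ℂ, memIcc a (aeval z R) → memIcc a z) (hz₀ : 0 < z₀) (hza : z₀ ≤ a) :
    ∃ ζ ξ ψ : ℂ → ℂ,
      (∀ s : ℂ, 2 * Real.log R.natDegree / Real.log c < s.re →
        Tendsto (fun n => zetaPartial R c z₀ n s) atTop (nhds (ζ s))) ∧
      Differentiable ℂ ξ ∧ DifferentiableOn ℂ ψ {s : ℂ | 0 < s.re} ∧
      ∀ s : ℂ, 2 * Real.log R.natDegree / Real.log c < s.re →
        ζ s = ξ s / (1 - (R.natDegree : ℂ) * (c : ℂ) ^ (-s / 2)) + ψ s := by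
  have hNc := natDegree_lt_derivative_eval_zero hR2 hR0 ha hinv
  rw [hc] at hNc
  have hN1 : (1 : ℝ) < R.natDegree := by exact_mod_cast (by omega : 1 < R.natDegree)
  have hc1 : 1 < c := hN1.trans hNc
  have hc0 : 0 < c := by linarith
  obtain ⟨U, hU, -, hUprod, hUcard, hUsum⟩ := exists_real_level_roots R hR0 ha
    fun z hz => hinv z (by rw [hz]; exact memIcc_ofReal ⟨ha.le, le_rfl⟩)
  set S : ℝ → ℝ := fun y => -R.eval (-y) with hS
  have hprod : ∀ y, 1 + S y / a = (U.map fun u => 1 + y / u).prod := by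
    intro y
    have := hUprod (-y)
    simpa [hS, neg_div, ← sub_eq_add_neg] using this
  have hE : ExpandingMap S c a := ExpandingMap.of_prod hc1 ha
    (by simp only [hS]; fun_prop) (fun u hu => (hU u hu).1) hprod (by rw [← hc, hUsum])
  obtain ⟨y, hym, hylim, hyge, hymono, hyS, t₀, ht₀, hysmall⟩ := hE.exists_limit
  obtain ⟨A₁, hA₁⟩ := exists_abs_log_sub_card_mul_log_le ha hz₀ (fun u hu => (hU u hu).1)
    (fun y hy => hE.nonneg hy) hprod
  rw [hUcard] at hA₁
  have hA0 : 0 ≤ A₁ := (abs_nonneg _).trans (hA₁ 0 le_rfl)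
  have hy0 : ∀ t, 0 ≤ t → 0 ≤ y t := fun t ht => ht.trans (hyge t ht 0)
  have hlog : ∀ u, 0 ≤ u → Real.log (1 + u / z₀) ≤ u / z₀ := fun u hu =>
    log_one_add_le (by positivity)
  have hy1 := hy0 1 zero_le_one
  have hyc := hy0 c hc0.le
  have hH : QuasiHomogeneous (fun t => Real.log (1 + y t / z₀)) c R.natDegree
      (A₁ + 2 / z₀ + y 1 / (z₀ * t₀) + y c / z₀) := by
    refine ⟨by fun_prop, hN1, hNc, fun t ht => ?_, fun t ht ht1 => ?_, fun t ht htc => ?_,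
      fun t ht => ?_⟩
    · have := div_nonneg (hy0 t ht.le) hz₀.le
      exact Real.log_nonneg (by linarith)
    · refine (hlog _ (hy0 t ht.le)).trans ?_
      rcases le_total t t₀ with h | h
      · calc y t / z₀ ≤ 2 * t / z₀ := by gcongr; exact hysmall t ht.le h
          _ = 2 / z₀ * t := by ring
          _ ≤ _ := by
            gcongr
            have : 0 ≤ y 1 / (z₀ * t₀) := by positivity
            have : 0 ≤ y c / z₀ := by positivity
            linarith
      · have h1 : y t ≤ y 1 := hymono ht.le (Set.mem_Ici.2 zero_le_one) ht1
        calc y t / z₀ ≤ y 1 / z₀ := by gcongr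
          _ = y 1 / (z₀ * t₀) * t₀ := by field_simp
          _ ≤ y 1 / (z₀ * t₀) * t := by gcongr
          _ ≤ _ := by
            gcongr
            have : 0 ≤ 2 / z₀ := by positivity
            have : 0 ≤ y c / z₀ := by positivity
            linarith
    · have ht0 : 0 ≤ t := by linarith
      refine (hlog _ (hy0 t ht0)).trans ?_
      have h1 : y t ≤ y c := hymono ht0 hc0.le htc
      have h2 : y t / z₀ ≤ y c / z₀ := by gcongr
      have : 0 ≤ 2 / z₀ := by positivity
      have : 0 ≤ y 1 / (z₀ * t₀) := by positivity
      linarith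
    · have h1 := hA₁ (y t) (hy0 t ht.le)
      rw [← hyS t ht.le] at h1
      have : 0 ≤ 2 / z₀ := by positivity
      have : 0 ≤ y 1 / (z₀ * t₀) := by positivity
      have : 0 ≤ y c / z₀ := by positivity
      linarith
  choose Λ hΛ hΛζ hΛprod using exists_scaled_roots hR0 hc0 hinv hz₀ hza
  have hΛlog : ∀ n t, 0 < t → ((Λ n).map fun x => Real.log (1 + t / x)).sum
      = Real.log (1 + scaledIter S c n t / z₀) := by
    intro n t ht
    rw [hΛprod, Real.log_multiset_prod, Multiset.map_map]
    · rfl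
    · intro x hx
      obtain ⟨u, hu, rfl⟩ := Multiset.mem_map.1 hx
      have := hΛ n u hu
      positivity
  obtain ⟨ζ, ξ, ψ, h1, h2, h3, h4⟩ := hH.exists_tendsto_powSum hΛ
    (fun n t ht => by
      rw [hΛlog n t ht]
      have := hE.scaledIter_nonneg n ht.le
      have := hyge t ht.le n
      apply Real.log_le_log (by positivity)
      gcongr)
    (fun t ht => by
      simp only [hΛlog _ t ht]
      have := hy0 t ht.le
      exact (((hylim t ht.le).div_const z₀).const_add 1).log (by positivity))
  refine ⟨ζ, ξ, ψ, fun s hs => ?_, h2, h3, fun s hs => ?_⟩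
  · simpa only [hΛζ] using h1 s hs
  · simpa using h4 s hs

/-- The roots of a composition `p ∘ q`, for `q` not constant. -/
theorem roots_comp_eq_bind (p : ℂ[X]) {q : ℂ[X]} (hq : 0 < q.natDegree) :
    (p.comp q).roots = p.roots.bind fun r => (q - C r).roots := by
  by_cases hp : p = 0
  · simp [hp]
  have hsp := (IsAlgClosed.splits p).eq_prod_roots
  have hne : ∀ r : ℂ, q - C r ≠ 0 := fun r h => by
    have := natDegree_sub_C (p := q) (a := r)
    rw [h, natDegree_zero] at this
    omega
  conv_lhs => rw [hsp]
  rw [mul_comp, C_comp, multiset_prod_comp, Multiset.map_map,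
    roots_C_mul _ (leadingCoeff_ne_zero.2 hp), roots_multiset_prod]
  · rw [Multiset.bind_map]
    refine Multiset.bind_congr fun r _ => ?_
    simp
  · intro h
    obtain ⟨r, -, hr⟩ := Multiset.mem_map.1 h
    exact hne r (by simpa using hr)

theorem natDegree_polyIter_pos {R : ℝ[X]} (hR : 0 < R.natDegree) (n : ℕ) :
    0 < (polyIter R n).natDegree := by
  induction n with
  | zero => simp [polyIter]
  | succ n ih => rw [polyIter, natDegree_comp]; positivity

/-- The zeros of `R`: a simple zero at the origin and positive zeros in `(0, a]`. -/
theorem exists_roots_eq_cons {R : ℝ[X]} (hR0 : R.eval 0 = 0) (hR1 : R.derivative.eval 0 ≠ 0)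
    {a : ℝ} (ha : 0 < a) (hinv : ∀ z : ℂ, memIcc a (aeval z R) → memIcc a z) :
    ∃ V : Multiset ℝ, (∀ r ∈ V, 0 < r ∧ r ≤ a) ∧
      (R.map (algebraMap ℝ ℂ)).roots = 0 ::ₘ V.map fun r : ℝ => (r : ℂ) := by
  have hX : R = R.divX * X := by
    conv_lhs => rw [← divX_mul_X_add R, coeff_zero_eq_eval_zero, hR0, C_0, add_zero]
  have hP0 : R.divX.eval 0 ≠ 0 := by
    rw [hX] at hR1
    simpa using hR1
  have hPne : (R.divX.map (algebraMap ℝ ℂ)) ≠ 0 := by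
    rw [Polynomial.map_ne_zero_iff (algebraMap ℝ ℂ).injective]
    intro h
    simp [h] at hP0
  have hroot : ∀ z ∈ (R.divX.map (algebraMap ℝ ℂ)).roots,
      z = (z.re : ℂ) ∧ 0 < z.re ∧ z.re ≤ a := by
    intro z hz
    have hz0 : aeval z R.divX = 0 := by
      have := isRoot_of_mem_roots hz
      rwa [IsRoot.def, eval_map_algebraMap] at this
    have hzR : aeval z R = 0 := by rw [hX, map_mul, hz0, zero_mul]
    obtain ⟨h1, h2⟩ := hinv z (by rw [hzR]; exact ⟨by simp, by simpa using ha.le⟩)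
    have hzre : z = (z.re : ℂ) := Complex.ext (by simp) (by simpa using h1)
    refine ⟨hzre, lt_of_le_of_ne h2.1 fun h0 => hP0 ?_, h2.2⟩
    have hz00 : z = ((0 : ℝ) : ℂ) := by rw [hzre, ← h0]
    rw [hz00] at hz0
    have := aeval_algebraMap_apply_eq_algebraMap_eval (A := ℂ) (0 : ℝ) R.divX
    rw [Complex.coe_algebraMap, hz0] at this
    exact_mod_cast this.symm
  refine ⟨(R.divX.map (algebraMap ℝ ℂ)).roots.map Complex.re, ?_, ?_⟩
  · intro r hr
    obtain ⟨z, hz, rfl⟩ := Multiset.mem_map.1 hr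
    exact (hroot z hz).2
  · conv_lhs => rw [hX]
    rw [Polynomial.map_mul, map_X, roots_mul (mul_ne_zero hPne X_ne_zero), roots_X, add_comm,
      Multiset.singleton_add, Multiset.map_map]
    congr 1
    conv_lhs => rw [← Multiset.map_id (R.divX.map (algebraMap ℝ ℂ)).roots]
    exact Multiset.map_congr rfl fun z hz => (hroot z hz).1

theorem zetaPartial_zero_succ {R : ℝ[X]} (hR : 0 < R.natDegree) {V : Multiset ℝ}
    (hV : (R.map (algebraMap ℝ ℂ)).roots = 0 ::ₘ V.map fun r : ℝ => (r : ℂ)) {c : ℝ} (hc : 0 < c)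
    (n : ℕ) (s : ℂ) :
    zetaPartial R c 0 (n + 1) s = (c : ℂ) ^ (-s / 2) *
      (zetaPartial R c 0 n s + (V.map fun r => zetaPartial R c r n s).sum) := by
  have hc0 : (c : ℂ) ≠ 0 := by exact_mod_cast hc.ne'
  have hterm : (fun z : ℂ => if z = 0 then 0 else ((c : ℂ) ^ (n + 1) * z) ^ (-s / 2))
      = fun z => (c : ℂ) ^ (-s / 2) * if z = 0 then 0 else ((c : ℂ) ^ n * z) ^ (-s / 2) := by
    funext z
    split_ifs with hz
    · simp
    · have h1 : (c : ℂ) ^ n * z ≠ 0 := mul_ne_zero (pow_ne_zero _ hc0) hz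
      rw [pow_succ', mul_assoc, Complex.cpow_def_of_ne_zero (mul_ne_zero hc0 h1),
        Complex.cpow_def_of_ne_zero hc0, Complex.cpow_def_of_ne_zero h1, ← Complex.exp_add,
        Complex.log_ofReal_mul hc h1, Complex.ofReal_log hc.le]
      ring_nf
  have hroots : preimageRoots R 0 (n + 1)
      = preimageRoots R 0 n + V.bind fun r => preimageRoots R r n := by
    have h1 : 0 < ((polyIter R n).map (algebraMap ℝ ℂ)).natDegree := by
      rw [natDegree_map]
      exact natDegree_polyIter_pos hR n
    simp only [preimageRoots, polyIter, C_0, sub_zero, Polynomial.map_sub, map_C]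
    rw [map_comp, roots_comp_eq_bind _ h1, hV, Multiset.cons_bind, Multiset.bind_map]
    simp
  rw [zetaPartial, hterm, hroots, Multiset.map_add, Multiset.sum_add, Multiset.map_bind,
    Multiset.sum_bind, Multiset.sum_map_mul_left, mul_add]
  congr 1
  rw [← Multiset.sum_map_mul_left]
  congr 1
  refine Multiset.map_congr rfl fun r _ => ?_
  rw [zetaPartial, Multiset.sum_map_mul_left]

theorem tendsto_zero_of_le_mul_add {u δ : ℕ → ℝ} {θ : ℝ} (hθ0 : 0 ≤ θ) (hθ1 : θ < 1)
    (hu : ∀ n, 0 ≤ u n) (hδ : Tendsto δ atTop (nhds 0)) (h : ∀ n, u (n + 1) ≤ θ * u n + δ n) :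
    Tendsto u atTop (nhds 0) := by
  rw [tendsto_order]
  refine ⟨fun b hb => Eventually.of_forall fun n => hb.trans_le (hu n), fun ε hε => ?_⟩
  have hη : 0 < (1 - θ) * (ε / 2) := mul_pos (by linarith) (by linarith)
  obtain ⟨m, hm⟩ := eventually_atTop.1 (hδ.eventually_le_const hη)
  have hk : ∀ k, u (m + k) ≤ ε / 2 + θ ^ k * u m := by
    intro k
    induction k with
    | zero => simp; linarith
    | succ k ih =>
      calc u (m + (k + 1)) ≤ θ * u (m + k) + δ (m + k) := h (m + k)
        _ ≤ θ * (ε / 2 + θ ^ k * u m) + (1 - θ) * (ε / 2) := by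
          gcongr
          exact hm _ (by omega)
        _ = _ := by ring
  have hlim : Tendsto (fun k => ε / 2 + θ ^ k * u m) atTop (nhds (ε / 2 + 0 * u m)) :=
    ((tendsto_pow_atTop_nhds_zero_of_lt_one hθ0 hθ1).mul_const _).const_add _
  obtain ⟨K, hK⟩ := eventually_atTop.1
    (hlim.eventually_lt_const (show ε / 2 + 0 * u m < ε by linarith))
  refine eventually_atTop.2 ⟨m + K, fun n hn => ?_⟩
  obtain ⟨k, rfl⟩ := Nat.exists_eq_add_of_le (show m ≤ n by omega)
  exact (hk k).trans_lt (hK k (by omega))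

theorem tendsto_of_affine_recurrence {x b : ℕ → ℂ} {q β : ℂ} (hq : ‖q‖ < 1)
    (hb : Tendsto b atTop (nhds β)) (h : ∀ n, x (n + 1) = q * (x n + b n)) :
    Tendsto x atTop (nhds (q * β / (1 - q))) := by
  have hq1 : 1 - q ≠ 0 := by
    intro h0
    rw [← sub_eq_zero.1 h0] at hq
    simp at hq
  rw [tendsto_iff_norm_sub_tendsto_zero]
  refine tendsto_zero_of_le_mul_add (δ := fun n => ‖q * (b n - β)‖) (norm_nonneg q) hq
    (fun _ => norm_nonneg _) ?_ fun n => ?_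
  · have := ((hb.sub_const β).const_mul q).norm
    simpa using this
  · rw [← norm_mul]
    refine le_trans (le_of_eq ?_) (norm_add_le _ _)
    congr 1
    rw [h]
    field_simp
    ring

/-- Summing the claim over finitely many positive base points. -/
theorem exists_zeta_sum {R : ℝ[X]} (hR2 : 2 ≤ R.natDegree) (hR0 : R.eval 0 = 0)
    {a c : ℝ} (hc : R.derivative.eval 0 = c) (ha : 0 < a)
    (hinv : ∀ z : ℂ, memIcc a (aeval z R) → memIcc a z) {V : Multiset ℝ}
    (hV : ∀ r ∈ V, 0 < r ∧ r ≤ a) :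
    ∃ ζ ξ ψ : ℂ → ℂ,
      (∀ s : ℂ, 2 * Real.log R.natDegree / Real.log c < s.re →
        Tendsto (fun n => (V.map fun r => zetaPartial R c r n s).sum) atTop (nhds (ζ s))) ∧
      Differentiable ℂ ξ ∧ DifferentiableOn ℂ ψ {s : ℂ | 0 < s.re} ∧
      ∀ s : ℂ, 2 * Real.log R.natDegree / Real.log c < s.re →
        ζ s = ξ s / (1 - (R.natDegree : ℂ) * (c : ℂ) ^ (-s / 2)) + ψ s := by
  induction V using Multiset.induction_on with
  | empty =>
    exact ⟨fun _ => 0, fun _ => 0, fun _ => 0, by simp, by fun_prop, by fun_prop, by simp⟩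
  | cons r V ih =>
    have hr := hV r (Multiset.mem_cons_self r V)
    obtain ⟨ζ₁, ξ₁, ψ₁, h1, h2, h3, h4⟩ := ih fun r hr => hV r (Multiset.mem_cons_of_mem hr)
    obtain ⟨ζ₂, ξ₂, ψ₂, k1, k2, k3, k4⟩ := exists_zeta_of_pos hR2 hR0 hc ha hinv hr.1 hr.2
    refine ⟨fun s => ζ₂ s + ζ₁ s, fun s => ξ₂ s + ξ₁ s, fun s => ψ₂ s + ψ₁ s, fun s hs => ?_,
      k2.add h2, k3.add h3, fun s hs => ?_⟩
    · simpa using (k1 s hs).add (h1 s hs)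
    · simp only [h4 s hs, k4 s hs]
      ring

/-- The claim for the base point `0`. -/
theorem exists_zeta_zero {R : ℝ[X]} (hR2 : 2 ≤ R.natDegree) (hR0 : R.eval 0 = 0)
    {a c : ℝ} (hc : R.derivative.eval 0 = c) (hc1 : 1 < c) (ha : 0 < a)
    (hinv : ∀ z : ℂ, memIcc a (aeval z R) → memIcc a z) :
    ∃ ζ ξ ψ : ℂ → ℂ,
      (∀ s : ℂ, 2 * Real.log R.natDegree / Real.log c < s.re →
        Tendsto (fun n => zetaPartial R c 0 n s) atTop (nhds (ζ s))) ∧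
      Differentiable ℂ ξ ∧ DifferentiableOn ℂ ψ {s : ℂ | 0 < s.re} ∧
      ∀ s : ℂ, 2 * Real.log R.natDegree / Real.log c < s.re →
        ζ s = ξ s / (1 - (R.natDegree : ℂ) * (c : ℂ) ^ (-s / 2)) + ψ s := by
  have hc0 : 0 < c := by linarith
  have hcC : (c : ℂ) ≠ 0 := by exact_mod_cast hc0.ne'
  obtain ⟨V, hV, hroots⟩ := exists_roots_eq_cons hR0 (by rw [hc]; exact hc0.ne') ha hinv
  obtain ⟨ζ, ξ, ψ, hζ, hξ, hψ, heq⟩ := exists_zeta_sum hR2 hR0 hc ha hinv hV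
  have hq : ∀ s : ℂ, 0 < s.re → ‖(c : ℂ) ^ (-s / 2)‖ < 1 := by
    intro s hs
    have hre : (-s / 2).re = -(s.re / 2) := by simp [neg_div]
    rw [Complex.norm_cpow_eq_rpow_re_of_pos hc0, hre]
    exact Real.rpow_lt_one_of_one_lt_of_neg hc1 (by linarith)
  have hq1 : ∀ s : ℂ, 0 < s.re → 1 - (c : ℂ) ^ (-s / 2) ≠ 0 := by
    intro s hs h
    have h1 := hq s hs
    rw [← sub_eq_zero.1 h] at h1
    simp at h1
  have hN1 : (1 : ℝ) < R.natDegree := by exact_mod_cast (by omega : 1 < R.natDegree)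
  have hd0 : 0 < 2 * Real.log R.natDegree / Real.log c :=
    div_pos (mul_pos two_pos (Real.log_pos hN1)) (Real.log_pos hc1)
  have hNC : (R.natDegree : ℂ) - 1 ≠ 0 := by
    intro h
    have : (R.natDegree : ℂ) = (1 : ℕ) := by simpa using sub_eq_zero.1 h
    have := Nat.cast_injective this
    omega
  have hqd : ∀ s : ℂ, DifferentiableAt ℂ (fun s : ℂ => (c : ℂ) ^ (-s / 2)) s := fun s =>
    DifferentiableAt.const_cpow (by fun_prop) (Or.inl hcC)
  refine ⟨fun s => (c : ℂ) ^ (-s / 2) * ζ s / (1 - (c : ℂ) ^ (-s / 2)),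
    fun s => ξ s / (R.natDegree - 1),
    fun s => ((c : ℂ) ^ (-s / 2) * ψ s - ξ s / (R.natDegree - 1)) / (1 - (c : ℂ) ^ (-s / 2)),
    fun s hs => ?_, hξ.div_const _, fun s hs => ?_, fun s hs => ?_⟩
  · exact tendsto_of_affine_recurrence (hq s (hd0.trans hs)) (hζ s hs) fun n =>
      zetaPartial_zero_succ (by omega) hroots hc0 n s
  · exact (((hqd s).differentiableWithinAt.mul (hψ s hs)).sub
      ((hξ s).div_const _).differentiableWithinAt).div
      ((hqd s).const_sub 1).differentiableWithinAt (hq1 s hs)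
  · beta_reduce
    rw [heq s hs]
    have h1 := hq1 s (hd0.trans hs)
    have h2 := one_sub_mul_cpow_ne_zero hc1 (by linarith) hs
    rw [Complex.ofReal_natCast] at h2
    generalize (c : ℂ) ^ (-s / 2) = q at h1 h2 ⊢
    generalize (R.natDegree : ℂ) = m at h2 hNC ⊢
    generalize hw : 1 - m * q = w at h2 ⊢
    field_simp
    rw [← hw]
    ring

theorem zeta_of_polynomial_meromorphic_continuation
    (R : Polynomial ℝ) (N : ℕ) (hN : R.natDegree = N) (hN2 : 2 ≤ N)
    (hR0 : R.eval 0 = 0) (c : ℝ) (hc : R.derivative.eval 0 = c) (hc1 : 1 < c)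
    (a : ℝ) (ha : 0 < a)
    (hinv : ∀ z : ℂ, memIcc a (Polynomial.aeval z R) → memIcc a z)
    (z₀ : ℝ) (hz₀ : z₀ ∈ Set.Icc 0 a) :
    ∃ zeta : ℂ → ℂ,
      (∀ s : ℂ, 2 * Real.log N / Real.log c < s.re →
        Filter.Tendsto (fun n => zetaPartial R c z₀ n s) Filter.atTop (nhds (zeta s))) ∧
      ∃ ξ ψ : ℂ → ℂ,
        Differentiable ℂ ξ ∧
        DifferentiableOn ℂ ψ {s : ℂ | 0 < s.re} ∧
        ∀ s : ℂ, 2 * Real.log N / Real.log c < s.re →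
          zeta s = ξ s / (1 - (N : ℂ) * (c : ℂ) ^ (-s / 2)) + ψ s := by
  subst hN
  rcases eq_or_lt_of_le hz₀.1 with rfl | h0
  · obtain ⟨ζ, ξ, ψ, h1, h2⟩ := exists_zeta_zero hN2 hR0 hc hc1 ha hinv
    exact ⟨ζ, h1, ξ, ψ, h2⟩
  · obtain ⟨ζ, ξ, ψ, h1, h2⟩ := exists_zeta_of_pos hN2 hR0 hc ha hinv h0 hz₀.2
    exact ⟨ζ, h1, ξ, ψ, h2⟩
end
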